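/- For coprime positive integers a, d, let S'_{d;a} be the set of positive integers all of whose prime factors are ≡ a (mod d) (with 1 ∈ S'_{d;a}), and let S'_{d;a}(x) denote the number of n ≤ x with n ∈ S'_{d;a}. Then for every real x ≥ 0: S'_{3;2}(x) ≥ S'_{3;1}(x), S'_{4;3}(x) ≥ S'_{3;1}(x), S'_{3;2}(x) ≥ S'_{4;1}(x), and S'_{4;3}(x) ≥ S'_{4;1}(x). -/

import Mathlib

open scoped Classical

/-- `S'_{d;a}`: the set of positive integers all of whose prime factors are
`≡ a (mod d)`. -/
def SArith (d a : ℕ) : Set ℕ :=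
  {n : ℕ | 0 < n ∧ ∀ p : ℕ, p.Prime → p ∣ n → p % d = a % d}

/-- `S'_{d;a}(x)`: the number of `n ≤ x` with `n ∈ S'_{d;a}`. -/
noncomputable def setCount (S : Set ℕ) (x : ℝ) : ℕ :=
  {n : ℕ | 0 < n ∧ (n : ℝ) ≤ x ∧ n ∈ S}.ncard

namespace PrimeRace
open ArithmeticFunction Finset

/-- The indicator function of the positive integers `n` such that the exponent of every prime `q`
in `n` satisfies `L q`. -/
noncomputable def locInd (L : ℕ → ℕ → Prop) : ArithmeticFunction ℝ :=
  ⟨fun n => if n ≠ 0 ∧ ∀ q, q.Prime → L q (n.factorization q) then 1 else 0, by simp⟩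

lemma locInd_apply (L : ℕ → ℕ → Prop) (n : ℕ) :
    locInd L n = if n ≠ 0 ∧ ∀ q, q.Prime → L q (n.factorization q) then 1 else 0 := rfl

lemma locInd_nonneg (L : ℕ → ℕ → Prop) (n : ℕ) : 0 ≤ locInd L n := by
  rw [locInd_apply]; split_ifs <;> norm_num

lemma locInd_le_one (L : ℕ → ℕ → Prop) (n : ℕ) : locInd L n ≤ 1 := by
  rw [locInd_apply]; split_ifs <;> norm_num

lemma locInd_prime_pow {L : ℕ → ℕ → Prop} (h0 : ∀ q, L q 0) {p : ℕ} (hp : p.Prime) (k : ℕ) :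
    locInd L (p ^ k) = if L p k then 1 else 0 := by
  rw [locInd_apply]
  congr 1
  rw [hp.factorization_pow]
  refine propext ⟨fun h => by simpa using h.2 p hp, fun h => ⟨(pow_pos hp.pos k).ne', ?_⟩⟩
  intro q _
  by_cases hq : q = p
  · subst hq; simpa using h
  · rw [Finsupp.single_eq_of_ne hq]; exact h0 q

lemma locInd_isMultiplicative {L : ℕ → ℕ → Prop} (h0 : ∀ q, L q 0) :
    (locInd L).IsMultiplicative := by
  rw [IsMultiplicative.iff_ne_zero]
  refine ⟨by simp [locInd_apply, h0], fun {m n} hm hn hmn => ?_⟩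
  have key : (∀ q, q.Prime → L q ((m * n).factorization q)) ↔
      (∀ q, q.Prime → L q (m.factorization q)) ∧ (∀ q, q.Prime → L q (n.factorization q)) := by
    rw [← forall₂_and]
    refine forall₂_congr fun q hq => ?_
    rw [Nat.factorization_mul hm hn, Finsupp.add_apply]
    have : m.factorization q = 0 ∨ n.factorization q = 0 := by
      by_contra! h
      have h1 := Nat.dvd_of_factorization_pos h.1
      have h2 := Nat.dvd_of_factorization_pos h.2
      exact hq.one_lt.ne' (Nat.dvd_one.mp (hmn ▸ Nat.dvd_gcd h1 h2))
    rcases this with h | h <;> simp [h, h0]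
  simp only [locInd_apply, key, ne_eq, mul_ne_zero hm hn, hm, hn, not_false_eq_true, true_and]
  generalize (∀ q, q.Prime → L q (m.factorization q)) = a
  generalize (∀ q, q.Prime → L q (n.factorization q)) = b
  by_cases a <;> by_cases b <;> simp [*]

/-- A completely multiplicative function, as an arithmetic function. -/
noncomputable def toArith (ψ : ℕ →*₀ ℝ) : ArithmeticFunction ℝ := ⟨ψ, map_zero ψ⟩

@[simp] lemma toArith_apply (ψ : ℕ →*₀ ℝ) (n : ℕ) : toArith ψ n = ψ n := rfl

lemma toArith_isMultiplicative (ψ : ℕ →*₀ ℝ) : (toArith ψ).IsMultiplicative := by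
  rw [IsMultiplicative.iff_ne_zero]
  exact ⟨by simp, fun _ _ _ => by simp⟩

lemma locInd_mul_toArith {L L' : ℕ → ℕ → Prop} (ψ : ℕ →*₀ ℝ) (h0 : ∀ q, L q 0) (h0' : ∀ q, L' q 0)
    (h : ∀ p, p.Prime → ∀ k, (if L' p (k + 1) then (1 : ℝ) else 0) =
      ψ p * (if L' p k then 1 else 0) + if L p (k + 1) then 1 else 0) :
    locInd L * toArith ψ = locInd L' := by
  refine (IsMultiplicative.eq_iff_eq_on_prime_powers _
    ((locInd_isMultiplicative h0).mul (toArith_isMultiplicative ψ)) _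
    (locInd_isMultiplicative h0')).2 fun p k hp => ?_
  have hs : ∀ k, (locInd L * toArith ψ) (p ^ k) =
      ∑ i ∈ range (k + 1), locInd L (p ^ i) * ψ p ^ (k - i) := by
    intro k
    rw [mul_apply, Nat.sum_divisorsAntidiagonal (fun i j => locInd L i * toArith ψ j),
      Nat.sum_divisors_prime_pow hp]
    refine sum_congr rfl fun i hi => ?_
    rw [Nat.pow_div (by simpa [Nat.lt_succ_iff] using hi) hp.pos]
    simp
  rw [hs]
  induction k with
  | zero => simp [(locInd_isMultiplicative h0).map_one, (locInd_isMultiplicative h0').map_one]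
  | succ k ih =>
    rw [sum_range_succ, locInd_prime_pow h0' hp, h p hp k, ← locInd_prime_pow h0' hp, ← ih,
      mul_sum]
    congr 1
    · refine sum_congr rfl fun i hi => ?_
      rw [Nat.succ_sub (by simpa [Nat.lt_succ_iff] using hi), pow_succ]
      ring
    · simp [locInd_prime_pow h0 hp]

lemma locInd_eq_one_iff {L : ℕ → ℕ → Prop} {n : ℕ} :
    locInd L n = 1 ↔ n ≠ 0 ∧ ∀ q, q.Prime → L q (n.factorization q) := by
  rw [locInd_apply]
  split_ifs with h
  · exact iff_of_true rfl h
  · exact iff_of_false (by norm_num) h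

lemma locInd_eq_zero_or_one (L : ℕ → ℕ → Prop) (n : ℕ) : locInd L n = 0 ∨ locInd L n = 1 := by
  rw [locInd_apply]; split_ifs <;> simp

lemma locInd_mul {L : ℕ → ℕ → Prop} (hL : ∀ q i j, L q i → L q j → L q (i + j)) {m n : ℕ}
    (hm : locInd L m = 1) (hn : locInd L n = 1) : locInd L (m * n) = 1 := by
  rw [locInd_eq_one_iff] at *
  refine ⟨mul_ne_zero hm.1 hn.1, fun q hq => ?_⟩
  rw [Nat.factorization_mul hm.1 hn.1]
  exact hL q _ _ (hm.2 q hq) (hn.2 q hq)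

lemma locInd_of_dvd {L : ℕ → ℕ → Prop} (hL : ∀ q i j, i ≤ j → L q j → L q i) {m n : ℕ}
    (hmn : m ∣ n) (hn : locInd L n = 1) : locInd L m = 1 := by
  rw [locInd_eq_one_iff] at *
  have hm : m ≠ 0 := ne_zero_of_dvd_ne_zero hn.1 hmn
  exact ⟨hm, fun q hq => hL q _ _ ((Nat.factorization_le_iff_dvd hm hn.1).2 hmn q) (hn.2 q hq)⟩

lemma sum_vonMangoldt_antidiagonal (n : ℕ) :
    ∑ x ∈ n.divisorsAntidiagonal, vonMangoldt x.1 = Real.log n := by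
  have := congrArg (fun f : ArithmeticFunction ℝ => f n) vonMangoldt_mul_zeta
  simp only [mul_apply, log_apply] at this
  rw [← this]
  refine sum_congr rfl fun x hx => ?_
  have h := Nat.ne_zero_of_mem_divisorsAntidiagonal hx
  simp [h.2]

lemma log_mul_locInd_ge {L : ℕ → ℕ → Prop} (hL : ∀ q i j, L q i → L q j → L q (i + j)) (n : ℕ) :
    (pmul (locInd L) vonMangoldt * locInd L) n ≤ locInd L n * Real.log n := by
  rw [← sum_vonMangoldt_antidiagonal, mul_sum, mul_apply]
  refine sum_le_sum fun x hx => ?_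
  rw [pmul_apply]
  have hΛ : 0 ≤ vonMangoldt x.1 := vonMangoldt_nonneg
  rw [← (Nat.mem_divisorsAntidiagonal.1 hx).1]
  rcases locInd_eq_zero_or_one L x.1 with h | h <;> rcases locInd_eq_zero_or_one L x.2 with h' | h'
  · simp only [h, h']; have := mul_nonneg (locInd_nonneg L (x.1 * x.2)) hΛ; simpa
  · simp only [h, h']; have := mul_nonneg (locInd_nonneg L (x.1 * x.2)) hΛ; simpa
  · simp only [h, h']; have := mul_nonneg (locInd_nonneg L (x.1 * x.2)) hΛ; simpa
  · rw [locInd_mul hL h h', h, h']; simp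

lemma log_mul_locInd_le {L : ℕ → ℕ → Prop} (hL : ∀ q i j, i ≤ j → L q j → L q i) (n : ℕ) :
    locInd L n * Real.log n ≤ (pmul (locInd L) vonMangoldt * locInd L) n := by
  rw [← sum_vonMangoldt_antidiagonal, mul_sum, mul_apply]
  refine sum_le_sum fun x hx => ?_
  rw [pmul_apply]
  have hΛ : 0 ≤ vonMangoldt x.1 := vonMangoldt_nonneg
  have hx' := (Nat.mem_divisorsAntidiagonal.1 hx).1
  rcases locInd_eq_zero_or_one L n with h | h
  · rw [h, zero_mul]
    exact mul_nonneg (mul_nonneg (locInd_nonneg _ _) hΛ) (locInd_nonneg _ _)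
  · rw [locInd_of_dvd hL ⟨_, hx'.symm⟩ h,
      locInd_of_dvd hL ⟨_, (mul_comm _ _).trans hx' |>.symm⟩ h, h]
    simp

/-- The summatory function. -/
noncomputable def psum (f : ArithmeticFunction ℝ) (N : ℕ) : ℝ := ∑ n ∈ Ioc 0 N, f n

@[simp] lemma psum_zero (f : ArithmeticFunction ℝ) : psum f 0 = 0 := by simp [psum]

lemma psum_succ (f : ArithmeticFunction ℝ) (N : ℕ) : psum f (N + 1) = psum f N + f (N + 1) := by
  rw [psum, psum, sum_Ioc_succ_top (by omega)]

lemma psum_add (f g : ArithmeticFunction ℝ) (N : ℕ) : psum (f + g) N = psum f N + psum g N := by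
  simp [psum, sum_add_distrib]

lemma psum_mul (f g : ArithmeticFunction ℝ) (N : ℕ) :
    psum (f * g) N = ∑ n ∈ Ioc 0 N, f n * psum g (N / n) := sum_Ioc_mul_eq_sum_sum f g N

lemma psum_mono {f g : ArithmeticFunction ℝ} (h : ∀ n, f n ≤ g n) (N : ℕ) : psum f N ≤ psum g N :=
  sum_le_sum fun n _ => h n

lemma pmul_vonMangoldt_mul (ψ : ℕ →*₀ ℝ) :
    pmul (toArith ψ) vonMangoldt * toArith ψ = pmul (toArith ψ) log := by
  ext n
  rw [mul_apply, pmul_apply, log_apply, ← sum_vonMangoldt_antidiagonal, mul_sum]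
  refine sum_congr rfl fun x hx => ?_
  rw [← (Nat.mem_divisorsAntidiagonal.1 hx).1]
  simp only [pmul_apply, toArith_apply, map_mul]
  ring

lemma arith_mul_le_mul {f g h : ArithmeticFunction ℝ} (hfg : ∀ n, f n ≤ g n) (hh : ∀ n, 0 ≤ h n)
    (n : ℕ) : (f * h) n ≤ (g * h) n := by
  rw [mul_apply, mul_apply]
  exact sum_le_sum fun x _ => mul_le_mul_of_nonneg_right (hfg _) (hh _)

/-- The von Mangoldt function restricted to the integers coprime to `6`. -/
noncomputable def mangoldtSix : ArithmeticFunction ℝ :=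
  ⟨fun n => if n % 2 ≠ 0 ∧ n % 3 ≠ 0 then vonMangoldt n else 0, by simp⟩

lemma mangoldtSix_apply (n : ℕ) :
    mangoldtSix n = if n % 2 ≠ 0 ∧ n % 3 ≠ 0 then vonMangoldt n else 0 := rfl

lemma mangoldtSix_nonneg (n : ℕ) : 0 ≤ mangoldtSix n := by
  rw [mangoldtSix_apply]; split_ifs <;> simp

/-- The basic inequality for the logarithmically weighted difference of two counting functions. -/
theorem log_weighted_ge {P T R A : ℕ → ℕ → Prop} {ψ χ : ℕ →*₀ ℝ} {w : ArithmeticFunction ℝ}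
    (hT : ∀ q i j, T q i → T q j → T q (i + j)) (hA : ∀ q i j, i ≤ j → A q j → A q i)
    (hPT : locInd P * toArith ψ = locInd T) (hRA : locInd R * toArith χ = locInd A)
    (hw : ∀ q, mangoldtSix q + w q + ψ q * vonMangoldt q ≤ 2 * (locInd T q * vonMangoldt q))
    (hv : ∀ q, 2 * (locInd A q * vonMangoldt q) ≤ mangoldtSix q + χ q * vonMangoldt q) (N : ℕ) :
    (∑ q ∈ Ioc 0 N, mangoldtSix q * (psum (locInd T) (N / q) - psum (locInd A) (N / q)))
      + (∑ n ∈ Ioc 0 N, locInd P n * psum (w * toArith ψ + pmul (toArith ψ) log) (N / n))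
      + (∑ n ∈ Ioc 0 N, locInd R n * -psum (pmul (toArith χ) log) (N / n))
      ≤ 2 * ∑ n ∈ Ioc 0 N, (locInd T n - locInd A n) * Real.log n := by
  have h1 : ∀ n, ((mangoldtSix * locInd T) n +
      (locInd P * (w * toArith ψ + pmul (toArith ψ) log)) n)
      ≤ 2 * (locInd T n * Real.log n) := by
    intro n
    have e : mangoldtSix * locInd T + locInd P * (w * toArith ψ + pmul (toArith ψ) log) =
        (mangoldtSix + w + pmul (toArith ψ) vonMangoldt) * locInd T := by
      rw [← pmul_vonMangoldt_mul, ← hPT]; ring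
    rw [← ArithmeticFunction.add_apply, e]
    refine le_trans (arith_mul_le_mul (g :=
      pmul (locInd T) vonMangoldt + pmul (locInd T) vonMangoldt) ?_ (locInd_nonneg T) n) ?_
    · intro q
      have := hw q
      simp only [ArithmeticFunction.add_apply, pmul_apply, toArith_apply]
      linarith
    · have := log_mul_locInd_ge hT n
      rw [add_mul, ArithmeticFunction.add_apply]
      linarith
  have h2 : ∀ n, 2 * (locInd A n * Real.log n) ≤
      ((mangoldtSix * locInd A) n + (locInd R * pmul (toArith χ) log) n) := by
    intro n
    have e : mangoldtSix * locInd A + locInd R * pmul (toArith χ) log =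
        (mangoldtSix + pmul (toArith χ) vonMangoldt) * locInd A := by
      rw [← pmul_vonMangoldt_mul, ← hRA]; ring
    rw [← ArithmeticFunction.add_apply, e]
    refine le_trans ?_ (arith_mul_le_mul (f :=
      pmul (locInd A) vonMangoldt + pmul (locInd A) vonMangoldt) ?_ (locInd_nonneg A) n)
    · have := log_mul_locInd_le hA n
      rw [add_mul, ArithmeticFunction.add_apply]
      linarith
    · intro q
      have := hv q
      simp only [ArithmeticFunction.add_apply, pmul_apply, toArith_apply]
      linarith
  have h3 := sum_le_sum fun n (_ : n ∈ Ioc 0 N) => h1 n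
  have h4 := sum_le_sum fun n (_ : n ∈ Ioc 0 N) => h2 n
  rw [sum_add_distrib] at h3 h4
  change psum _ N + psum _ N ≤ _ at h3
  change _ ≤ psum _ N + psum _ N at h4
  rw [psum_mul, psum_mul] at h3 h4
  simp only [mul_sub, sub_mul, mul_neg, sum_neg_distrib, sum_sub_distrib]
  rw [← mul_sum] at h3 h4
  linarith

lemma sum_mul_log_le {f : ArithmeticFunction ℝ} {N : ℕ} (h : ∀ m < N, 0 ≤ psum f m) :
    ∑ n ∈ Ioc 0 N, f n * Real.log n ≤ psum f N * Real.log N := by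
  induction N with
  | zero => simp
  | succ N ih =>
    rw [sum_Ioc_succ_top (by omega), psum_succ, add_mul]
    refine add_le_add ((ih fun m hm => h m (by omega)).trans ?_) le_rfl
    refine mul_le_mul_of_nonneg_left ?_ (h N (by omega))
    rcases Nat.eq_zero_or_pos N with rfl | hN
    · simp
    · exact Real.log_le_log (by exact_mod_cast hN) (by push_cast; linarith)

lemma log_le_div_two_pow_add {z : ℝ} (hz : 0 < z) (j : ℕ) :
    Real.log z ≤ z / 2 ^ j + 0.69315 * j - 1 := by
  have h : Real.log z = Real.log (z / 2 ^ j) + j * Real.log 2 := by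
    rw [Real.log_div hz.ne' (by positivity), Real.log_pow]; ring
  have h1 := Real.log_le_sub_one_of_pos (show 0 < z / 2 ^ j by positivity)
  have h2 : (j : ℝ) * Real.log 2 ≤ j * 0.69315 :=
    mul_le_mul_of_nonneg_left (by linarith [Real.log_two_lt_d9]) (by positivity)
  linarith

lemma sum_vonMangoldt_dvd_le {p : ℕ} (hp : p.Prime) (m : ℕ) :
    ∑ q ∈ Ioc 0 m with p ∣ q, vonMangoldt q ≤ Real.log (m + 1) := by
  have hsub : (Ioc 0 (Nat.log p m)).image (fun k => p ^ k) ⊆ {q ∈ Ioc 0 m | p ∣ q} := by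
    intro q hq
    obtain ⟨k, hk, rfl⟩ := mem_image.1 hq
    rw [mem_Ioc] at hk
    have hm : m ≠ 0 := by
      rintro rfl
      simp at hk
      omega
    rw [mem_filter, mem_Ioc]
    exact ⟨⟨pow_pos hp.pos k, Nat.pow_le_of_le_log hm hk.2⟩, dvd_pow_self p (by omega)⟩
  rw [← sum_subset hsub, sum_image]
  · rw [sum_congr rfl (g := fun _ => Real.log p)]
    · rcases Nat.eq_zero_or_pos m with rfl | hm
      · simp
      rw [sum_const, Nat.card_Ioc, Nat.sub_zero, nsmul_eq_mul, ← Real.log_pow]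
      refine Real.log_le_log (by have := hp.pos; positivity) ?_
      have := Nat.pow_log_le_self p hm.ne'
      exact_mod_cast this.trans (Nat.le_succ m)
    · intro k hk
      rw [mem_Ioc] at hk
      rw [vonMangoldt_apply_pow (by omega), vonMangoldt_apply_prime hp]
  · intro a _ b _ hab
    exact Nat.pow_right_injective hp.two_le hab
  · intro q hq hq'
    rw [mem_filter, mem_Ioc] at hq
    refine vonMangoldt_eq_zero_iff.2 fun hpp => hq' ?_
    obtain ⟨r, k, hr, hk, rfl⟩ := (isPrimePow_nat_iff q).1 hpp
    obtain rfl := (Nat.prime_dvd_prime_iff_eq hp hr).1 (hp.dvd_of_dvd_pow hq.2)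
    exact mem_image.2 ⟨k, mem_Ioc.2 ⟨hk, Nat.le_log_of_pow_le hp.one_lt hq.1.2⟩, rfl⟩

lemma psum_vonMangoldt (m : ℕ) : psum vonMangoldt m = Chebyshev.psi m := by
  rw [psum, Chebyshev.psi, Nat.floor_natCast]

lemma psum_mangoldtSix_ge (m : ℕ) :
    m * Real.log 2 - 3 * Real.log (m + 1) ≤ psum mangoldtSix m := by
  have h : psum vonMangoldt m ≤ psum mangoldtSix m +
      ∑ q ∈ Ioc 0 m with 2 ∣ q, vonMangoldt q + ∑ q ∈ Ioc 0 m with 3 ∣ q, vonMangoldt q := by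
    rw [sum_filter, sum_filter, psum, psum, ← sum_add_distrib, ← sum_add_distrib]
    refine sum_le_sum fun q _ => ?_
    have hΛ : 0 ≤ vonMangoldt q := vonMangoldt_nonneg
    rw [mangoldtSix_apply]
    simp only [Nat.dvd_iff_mod_eq_zero]
    split_ifs <;> first | linarith | (exfalso; tauto)
  rw [psum_vonMangoldt] at h
  have h2 := sum_vonMangoldt_dvd_le Nat.prime_two m
  have h3 := sum_vonMangoldt_dvd_le Nat.prime_three m
  have := Chebyshev.psi_ge m
  linarith

lemma psum_mangoldtSix_le (m : ℕ) : psum mangoldtSix m ≤ 5.3863 * m := by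
  have h : psum mangoldtSix m ≤ Chebyshev.psi m := by
    rw [← psum_vonMangoldt]
    refine psum_mono (fun q => ?_) m
    rw [mangoldtSix_apply]
    split_ifs
    · exact le_rfl
    · exact vonMangoldt_nonneg
  have h4 : Real.log 4 = 2 * Real.log 2 := by
    rw [show (4 : ℝ) = 2 ^ 2 by norm_num, Real.log_pow]; norm_num
  refine (h.trans (Chebyshev.psi_le_const_mul_self (Nat.cast_nonneg m))).trans ?_
  refine mul_le_mul_of_nonneg_right ?_ (Nat.cast_nonneg m)
  linarith [Real.log_two_lt_d9]

lemma psum_mangoldtSix_div_ge {N y : ℕ} (hy : 0 < y) (hyN : y ≤ N) (j : ℕ) :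
    0.6931 * ((N : ℝ) / y - 1) - 3 * (((N : ℝ) / y + 1) / 2 ^ j + 0.69315 * j - 1)
      ≤ psum mangoldtSix (N / y) := by
  refine le_trans ?_ (psum_mangoldtSix_ge (N / y))
  have hy' : (0 : ℝ) < y := by exact_mod_cast hy
  have h1 : ((N / y : ℕ) : ℝ) ≤ (N : ℝ) / y := Nat.cast_div_le
  have h2 : (N : ℝ) / y < ((N / y : ℕ) : ℝ) + 1 := by
    rw [div_lt_iff₀ hy']
    exact_mod_cast (Nat.div_lt_iff_lt_mul hy).1 (Nat.lt_succ_self (N / y))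
  have h3 : Real.log (((N / y : ℕ) : ℝ) + 1) ≤ Real.log ((N : ℝ) / y + 1) :=
    Real.log_le_log (by positivity) (by linarith)
  have h4 := log_le_div_two_pow_add (show 0 < (N : ℝ) / y + 1 by positivity) j
  have h5 : 0.6931 * ((N : ℝ) / y - 1) ≤ ((N / y : ℕ) : ℝ) * Real.log 2 := by
    have h6 : (1 : ℝ) ≤ (N : ℝ) / y := by
      rw [one_le_div hy']; exact_mod_cast hyN
    have := Real.log_two_gt_d9
    rw [mul_comm]
    exact mul_le_mul (by linarith) (by linarith) (by norm_num) (by positivity)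
  linarith

/-- The total jump of the step function with jumps `x.2` at the points `x.1`, `x ∈ l`. -/
noncomputable def stepFun (l : List (ℕ × ℕ)) (n : ℕ) : ℝ :=
  (l.map fun x => if x.1 ≤ n then (x.2 : ℝ) else 0).sum

lemma sum_mangoldtSix_ite (N : ℕ) {y : ℕ} (hy : 0 < y) :
    ∑ q ∈ Ioc 0 N, mangoldtSix q * (if y ≤ N / q then 1 else 0) = psum mangoldtSix (N / y) := by
  simp only [mul_ite, mul_one, mul_zero]
  rw [← sum_filter, psum]
  refine sum_congr ?_ fun _ _ => rfl
  ext q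
  simp only [mem_filter, mem_Ioc]
  constructor
  · rintro ⟨⟨h1, h2⟩, h3⟩
    refine ⟨h1, (Nat.le_div_iff_mul_le hy).2 ?_⟩
    rw [mul_comm]
    exact (Nat.le_div_iff_mul_le h1).1 h3
  · rintro ⟨h1, h2⟩
    refine ⟨⟨h1, h2.trans (Nat.div_le_self _ _)⟩, (Nat.le_div_iff_mul_le h1).2 ?_⟩
    rw [mul_comm]
    exact (Nat.le_div_iff_mul_le hy).1 h2

lemma sum_mangoldtSix_ge {F : ℕ → ℝ} {l : List (ℕ × ℕ)} (hl : ∀ x ∈ l, 0 < x.1) {K N : ℕ}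
    (hF : ∀ n < N, 0 ≤ F n) (hK : ∀ n, 0 < n → n ≤ K → stepFun l n ≤ F n) :
    (l.map fun x => (x.2 : ℝ) * (psum mangoldtSix (N / x.1) - psum mangoldtSix (N / (K + 1)))).sum
      ≤ ∑ q ∈ Ioc 0 N, mangoldtSix q * F (N / q) := by
  have e : ∀ l : List (ℕ × ℕ), (∀ x ∈ l, 0 < x.1) →
      (l.map fun x => (x.2 : ℝ) *
        (psum mangoldtSix (N / x.1) - psum mangoldtSix (N / (K + 1)))).sum =
      ∑ q ∈ Ioc 0 N, mangoldtSix q * (l.map fun x => (x.2 : ℝ) *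
        ((if x.1 ≤ N / q then 1 else 0) - if K + 1 ≤ N / q then 1 else 0)).sum := by
    intro l hl
    induction l with
    | nil => simp
    | cons x l ih =>
      rw [List.map_cons, List.sum_cons, ih fun y hy => hl y (List.mem_cons_of_mem _ hy),
        ← sum_mangoldtSix_ite N (hl x List.mem_cons_self),
        ← sum_mangoldtSix_ite N (Nat.succ_pos K), ← sum_sub_distrib, mul_sum, ← sum_add_distrib]
      refine sum_congr rfl fun q _ => ?_
      rw [List.map_cons, List.sum_cons]
      simp only [Nat.succ_eq_add_one]
      ring
  rw [e l hl]
  refine sum_le_sum fun q hq => ?_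
  rw [mem_Ioc] at hq
  rcases Nat.lt_or_ge 1 q with h1 | h1
  · refine mul_le_mul_of_nonneg_left ?_ (mangoldtSix_nonneg q)
    have hpos : 0 < N / q := Nat.div_pos hq.2 hq.1
    rcases Nat.lt_or_ge K (N / q) with h | h
    · refine le_trans ?_ (hF _ (Nat.div_lt_self (hq.1.trans_le hq.2) h1))
      refine (List.sum_le_sum (g := fun _ => (0 : ℝ)) fun x _ => ?_).trans_eq (by simp)
      refine mul_nonpos_of_nonneg_of_nonpos (Nat.cast_nonneg _) ?_
      rw [if_pos (show K + 1 ≤ N / q from h)]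
      split_ifs <;> norm_num
    · refine le_of_eq_of_le ?_ (hK _ hpos h)
      rw [stepFun]
      congr 1
      refine List.map_congr_left fun x _ => ?_
      rw [if_neg (show ¬ K + 1 ≤ N / q by omega)]
      simp
  · obtain rfl : q = 1 := by omega
    have : mangoldtSix 1 = 0 := by simp [mangoldtSix_apply]
    rw [this]; simp

lemma sum_mul_log_sub_log_le {g : ArithmeticFunction ℝ} {α : ℝ}
    (hg : ∀ M : ℕ, psum g M ≤ α * M + 1) (hα : 0 ≤ α) (M : ℕ) :
    ∑ n ∈ Ioc 0 M, g n * (Real.log (M + 1) - Real.log n) ≤ α * M + Real.log (M + 1) := by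
  induction M with
  | zero => simp
  | succ M ih =>
    have e : ∑ n ∈ Ioc 0 (M + 1), g n * (Real.log ((M + 1 : ℕ) + 1) - Real.log n) =
        psum g (M + 1) * (Real.log ((M + 1 : ℕ) + 1) - Real.log (M + 1)) +
          ∑ n ∈ Ioc 0 M, g n * (Real.log (M + 1) - Real.log n) := by
      rw [psum_succ, psum, sum_Ioc_succ_top (by omega), add_mul, sum_mul]
      push_cast
      have hs : ∑ n ∈ Ioc 0 M, g n * (Real.log (M + 1 + 1) - Real.log n) =
          ∑ n ∈ Ioc 0 M, g n * (Real.log (M + 1 + 1) - Real.log (M + 1)) +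
            ∑ n ∈ Ioc 0 M, g n * (Real.log (M + 1) - Real.log n) := by
        rw [← sum_add_distrib]
        exact sum_congr rfl fun n _ => by ring
      rw [hs]
      ring
    have hM : (0 : ℝ) < M + 1 := by positivity
    have hd : Real.log ((M + 1 : ℕ) + 1) - Real.log (M + 1) ≤ 1 / (M + 1) := by
      rw [← Real.log_div (by positivity) hM.ne']
      refine (Real.log_le_sub_one_of_pos (by positivity)).trans_eq ?_
      push_cast
      field_simp
      ring
    have hd0 : 0 ≤ Real.log ((M + 1 : ℕ) + 1) - Real.log (M + 1) :=
      sub_nonneg.2 (Real.log_le_log hM (by push_cast; linarith))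
    have h1 := mul_le_mul_of_nonneg_right (hg (M + 1)) hd0
    have h2 := mul_le_mul_of_nonneg_left hd (mul_nonneg hα hM.le)
    have h3 : α * (M + 1) * (1 / (M + 1)) = α := by field_simp
    rw [e]
    push_cast at *
    linarith

lemma sum_mul_div_ge {g : ArithmeticFunction ℝ} {α : ℝ} (hg0 : ∀ n, 0 ≤ g n)
    (hg : ∀ M : ℕ, psum g M ≤ α * M + 1) (hα : 0 ≤ α) {H : ℕ → ℝ} {c lam : ℝ} {y₀ : ℕ}
    (hlam : 0 ≤ lam) (hc : 0 < c) (hy₀ : c ≤ y₀) (hH : ∀ y < y₀, 0 ≤ H y)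
    (hH' : ∀ y, y₀ ≤ y → -(lam * Real.log (y / c)) ≤ H y) (N : ℕ) :
    -(lam * (Real.log (y₀ / c) * (α * (N / y₀ : ℕ) + 1) + α * (N / y₀ : ℕ)
      + Real.log ((N / y₀ : ℕ) + 1))) ≤ ∑ n ∈ Ioc 0 N, g n * H (N / n) := by
  set M := N / y₀ with hM
  have hy' : (0 : ℝ) < y₀ := hc.trans_le hy₀
  have hy : 0 < y₀ := by exact_mod_cast hy'
  have hκ : 0 ≤ Real.log (y₀ / c) := Real.log_nonneg ((one_le_div hc).2 hy₀)
  have h1 : ∑ n ∈ Ioc 0 M, g n * H (N / n) ≤ ∑ n ∈ Ioc 0 N, g n * H (N / n) := by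
    refine sum_le_sum_of_subset_of_nonneg
      (Ioc_subset_Ioc_right (Nat.div_le_self _ _)) fun n hn hn' => ?_
    refine mul_nonneg (hg0 n) (hH _ ?_)
    rw [mem_Ioc] at hn hn'
    rw [Nat.div_lt_iff_lt_mul hn.1, mul_comm]
    rw [← Nat.div_lt_iff_lt_mul hy]
    omega
  refine le_trans ?_ h1
  have h2 : ∀ n ∈ Ioc 0 M, g n * -(lam * (Real.log (y₀ / c) + (Real.log (M + 1) - Real.log n)))
      ≤ g n * H (N / n) := by
    intro n hn
    rw [mem_Ioc] at hn
    have hn0 : (0 : ℝ) < n := by exact_mod_cast hn.1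
    have hyn : y₀ ≤ N / n := by
      rw [Nat.le_div_iff_mul_le hn.1, mul_comm]
      exact (Nat.le_div_iff_mul_le hy).1 hn.2
    refine mul_le_mul_of_nonneg_left (le_trans ?_ (hH' _ hyn)) (hg0 n)
    refine neg_le_neg (mul_le_mul_of_nonneg_left ?_ hlam)
    rw [← Real.log_div (by positivity) hn0.ne', ← Real.log_mul (by positivity) (by positivity)]
    have hpos : (0 : ℝ) < (N / n : ℕ) := by exact_mod_cast hy.trans_le hyn
    refine Real.log_le_log (by positivity) ?_
    have h3 : ((N / n : ℕ) : ℝ) ≤ (N : ℝ) / n := Nat.cast_div_le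
    have h4 : (N : ℝ) ≤ y₀ * (M + 1) := by
      have : N < y₀ * (M + 1) := by
        rw [mul_comm]
        exact (Nat.div_lt_iff_lt_mul hy).1 (Nat.lt_succ_self _)
      exact_mod_cast this.le
    calc ((N / n : ℕ) : ℝ) / c ≤ (N : ℝ) / n / c := by gcongr
      _ ≤ (y₀ * (M + 1)) / n / c := by gcongr
      _ = y₀ / c * ((M + 1) / n) := by field_simp
  refine le_trans ?_ (sum_le_sum h2)
  have h5 := sum_mul_log_sub_log_le hg hα M
  have h6 := mul_le_mul_of_nonneg_left (hg M) hκ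
  have e : ∑ n ∈ Ioc 0 M, g n * -(lam * (Real.log (y₀ / c) + (Real.log (M + 1) - Real.log n))) =
      -(lam * (Real.log (y₀ / c) * psum g M +
        ∑ n ∈ Ioc 0 M, g n * (Real.log (M + 1) - Real.log n))) := by
    rw [psum, mul_sum, ← sum_add_distrib, mul_sum, ← sum_neg_distrib]
    exact sum_congr rfl fun n _ => by ring
  rw [e]
  refine neg_le_neg (mul_le_mul_of_nonneg_left ?_ hlam)
  linarith

/-- The nontrivial character modulo `4`. -/
noncomputable def chiFour : ℕ →*₀ ℝ where
  toFun n := if n % 4 = 1 then 1 else if n % 4 = 3 then -1 else 0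
  map_zero' := by norm_num
  map_one' := by norm_num
  map_mul' m n := by
    have h := Nat.mul_mod m n 4
    have hm := Nat.mod_lt m (show 0 < 4 by norm_num)
    have hn := Nat.mod_lt n (show 0 < 4 by norm_num)
    rw [h]
    interval_cases m % 4 <;> interval_cases n % 4 <;> norm_num

/-- The nontrivial character modulo `6`. -/
noncomputable def chiSix : ℕ →*₀ ℝ where
  toFun n := if n % 6 = 1 then 1 else if n % 6 = 5 then -1 else 0
  map_zero' := by norm_num
  map_one' := by norm_num
  map_mul' m n := by
    have h := Nat.mul_mod m n 6
    have hm := Nat.mod_lt m (show 0 < 6 by norm_num)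
    have hn := Nat.mod_lt n (show 0 < 6 by norm_num)
    rw [h]
    interval_cases m % 6 <;> interval_cases n % 6 <;> norm_num

/-- The character modulo `12` induced by the nontrivial character modulo `4`. -/
noncomputable def chiTwelve : ℕ →*₀ ℝ where
  toFun n := if n % 12 = 1 ∨ n % 12 = 5 then 1 else if n % 12 = 7 ∨ n % 12 = 11 then -1 else 0
  map_zero' := by norm_num
  map_one' := by norm_num
  map_mul' m n := by
    have h := Nat.mul_mod m n 12
    have hm := Nat.mod_lt m (show 0 < 12 by norm_num)
    have hn := Nat.mod_lt n (show 0 < 12 by norm_num)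
    rw [h]
    interval_cases m % 12 <;> interval_cases n % 12 <;> norm_num

lemma chiFour_apply (n : ℕ) :
    chiFour n = if n % 4 = 1 then 1 else if n % 4 = 3 then -1 else 0 := rfl

lemma chiSix_apply (n : ℕ) :
    chiSix n = if n % 6 = 1 then 1 else if n % 6 = 5 then -1 else 0 := rfl

lemma chiTwelve_apply (n : ℕ) : chiTwelve n =
    if n % 12 = 1 ∨ n % 12 = 5 then 1 else if n % 12 = 7 ∨ n % 12 = 11 then -1 else 0 := rfl

lemma psum_chiFour (N : ℕ) :
    psum (toArith chiFour) N = if N % 4 = 1 ∨ N % 4 = 2 then 1 else 0 := by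
  induction N with
  | zero => simp
  | succ N ih =>
    rw [psum_succ, ih, toArith_apply, chiFour_apply]
    split_ifs <;> first | (exfalso; omega) | norm_num

lemma psum_chiSix (N : ℕ) :
    psum (toArith chiSix) N = if 1 ≤ N % 6 ∧ N % 6 ≤ 4 then 1 else 0 := by
  induction N with
  | zero => simp
  | succ N ih =>
    rw [psum_succ, ih, toArith_apply, chiSix_apply]
    split_ifs <;> first | (exfalso; omega) | norm_num

/-- The sum of `ψ n * log n` over `0 < n ≤ N`. -/
noncomputable def logSum (ψ : ℕ →*₀ ℝ) (N : ℕ) : ℝ := psum (pmul (toArith ψ) log) N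

@[simp] lemma logSum_zero (ψ : ℕ →*₀ ℝ) : logSum ψ 0 = 0 := psum_zero _

lemma logSum_succ (ψ : ℕ →*₀ ℝ) (N : ℕ) :
    logSum ψ (N + 1) = logSum ψ N + ψ (N + 1) * Real.log (N + 1) := by
  rw [logSum, psum_succ, pmul_apply, toArith_apply, log_apply]
  push_cast
  rfl

lemma logSum_chiFour_succ (N : ℕ) : logSum chiFour (N + 1) = logSum chiFour N +
    (if (N + 1) % 4 = 1 then 1 else if (N + 1) % 4 = 3 then -1 else 0) * Real.log (N + 1) := by
  rw [logSum_succ, chiFour_apply]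

lemma logSum_chiFour_add_three (j : ℕ) :
    -(1 / 2 * Real.log (3 * (4 * j + 3))) ≤ logSum chiFour (4 * j + 3) ∧
      logSum chiFour (4 * j + 4) = logSum chiFour (4 * j + 3) ∧
      0 ≤ logSum chiFour (4 * j + 5) ∧ 0 ≤ logSum chiFour (4 * j + 6) := by
  have e4 : ∀ j : ℕ, logSum chiFour (4 * j + 4) = logSum chiFour (4 * j + 3) := by
    intro j
    rw [logSum_chiFour_succ, if_neg (by omega), if_neg (by omega)]; ring
  have e5 : ∀ j : ℕ, logSum chiFour (4 * j + 5) =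
      logSum chiFour (4 * j + 3) + Real.log (4 * j + 5) := by
    intro j
    rw [logSum_chiFour_succ, if_pos (by omega), e4]; push_cast; ring_nf
  have e6 : ∀ j : ℕ, logSum chiFour (4 * j + 6) = logSum chiFour (4 * j + 5) := by
    intro j
    rw [logSum_chiFour_succ, if_neg (by omega), if_neg (by omega)]; ring
  have e7 : ∀ j : ℕ, logSum chiFour (4 * j + 7) =
      logSum chiFour (4 * j + 5) - Real.log (4 * j + 7) := by
    intro j
    rw [logSum_chiFour_succ, if_neg (by omega), if_pos (by omega), e6]; push_cast; ring_nf
  have main : ∀ j : ℕ,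
      -(1 / 2 * Real.log (3 * (4 * j + 3))) ≤ logSum chiFour (4 * j + 3) := by
    intro j
    induction j with
    | zero =>
      have h9 : Real.log 9 = 2 * Real.log 3 := by
        rw [show (9 : ℝ) = 3 ^ 2 by norm_num, Real.log_pow]; norm_num
      norm_num [logSum_chiFour_succ, h9]
      linarith
    | succ j ih =>
      rw [show 4 * (j + 1) + 3 = 4 * j + 7 by ring, e7, e5]
      have h := Real.log_le_log (x := (4 * (j : ℝ) + 7) ^ 2 * (3 * (4 * j + 3)))
        (y := (4 * (j : ℝ) + 5) ^ 2 * (3 * (4 * j + 7))) (by positivity) (by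
          have : (0 : ℝ) ≤ j := Nat.cast_nonneg j
          nlinarith)
      rw [Real.log_mul (x := (4 * (j : ℝ) + 7) ^ 2) (by positivity) (by positivity),
        Real.log_mul (x := (4 * (j : ℝ) + 5) ^ 2) (by positivity) (by positivity),
        Real.log_pow, Real.log_pow] at h
      push_cast at *
      rw [show 4 * ((j : ℝ) + 1) + 3 = 4 * j + 7 by ring]
      linarith
  have h5 : 0 ≤ logSum chiFour (4 * j + 5) := by
    rw [e5]
    have h := Real.log_le_log (x := 3 * (4 * (j : ℝ) + 3))
        (y := (4 * (j : ℝ) + 5) ^ 2) (by positivity) (by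
          have : (0 : ℝ) ≤ j := Nat.cast_nonneg j
          nlinarith)
    rw [Real.log_pow] at h
    have := main j
    push_cast at *
    linarith
  exact ⟨main j, e4 j, h5, by rw [e6]; exact h5⟩

lemma logSum_chiFour_ge {y : ℕ} (hy : 3 ≤ y) :
    -(1 / 2 * Real.log (3 * y)) ≤ logSum chiFour y := by
  have hpos : 0 ≤ 1 / 2 * Real.log (3 * (y : ℝ)) := by
    have : (3 : ℝ) ≤ y := by exact_mod_cast hy
    have := Real.log_nonneg (show (1 : ℝ) ≤ 3 * y by linarith)
    linarith
  obtain ⟨h1, h2, h3, h4⟩ := logSum_chiFour_add_three ((y - 3) / 4)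
  set j := (y - 3) / 4 with hj
  have hc : y = 4 * j + 3 ∨ y = 4 * j + 4 ∨ y = 4 * j + 5 ∨ y = 4 * j + 6 := by omega
  rcases hc with h | h | h | h
  · rw [h]; push_cast; exact h1
  · rw [h, h2]
    refine le_trans (neg_le_neg ?_) h1
    refine mul_le_mul_of_nonneg_left (Real.log_le_log (by positivity) ?_) (by norm_num)
    push_cast; linarith
  · rw [← h] at h3; linarith
  · rw [← h] at h4; linarith

lemma logSum_chiSix_succ (N : ℕ) : logSum chiSix (N + 1) = logSum chiSix N +
    (if (N + 1) % 6 = 1 then 1 else if (N + 1) % 6 = 5 then -1 else 0) * Real.log (N + 1) := by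
  rw [logSum_succ, chiSix_apply]

lemma logSum_chiSix_block (j : ℕ) :
    logSum chiSix (6 * j + 5) = logSum chiSix (6 * j + 1) - Real.log (6 * j + 5) ∧
      logSum chiSix (6 * j + 7) =
        logSum chiSix (6 * j + 1) - Real.log (6 * j + 5) + Real.log (6 * j + 7) ∧
      logSum chiSix (6 * j + 2) = logSum chiSix (6 * j + 1) ∧
      logSum chiSix (6 * j + 3) = logSum chiSix (6 * j + 1) ∧
      logSum chiSix (6 * j + 4) = logSum chiSix (6 * j + 1) ∧
      logSum chiSix (6 * j + 6) = logSum chiSix (6 * j + 5) := by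
  have e2 : logSum chiSix (6 * j + 2) = logSum chiSix (6 * j + 1) := by
    rw [logSum_chiSix_succ, if_neg (by omega), if_neg (by omega)]; ring
  have e3 : logSum chiSix (6 * j + 3) = logSum chiSix (6 * j + 2) := by
    rw [logSum_chiSix_succ, if_neg (by omega), if_neg (by omega)]; ring
  have e4 : logSum chiSix (6 * j + 4) = logSum chiSix (6 * j + 3) := by
    rw [logSum_chiSix_succ, if_neg (by omega), if_neg (by omega)]; ring
  have e5 : logSum chiSix (6 * j + 5) = logSum chiSix (6 * j + 4) - Real.log (6 * j + 5) := by
    rw [logSum_chiSix_succ, if_neg (by omega), if_pos (by omega)]; push_cast; ring_nf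
  have e6 : logSum chiSix (6 * j + 6) = logSum chiSix (6 * j + 5) := by
    rw [logSum_chiSix_succ, if_neg (by omega), if_neg (by omega)]; ring
  have e7 : logSum chiSix (6 * j + 7) = logSum chiSix (6 * j + 6) + Real.log (6 * j + 7) := by
    rw [logSum_chiSix_succ, if_pos (by omega)]; push_cast; ring_nf
  refine ⟨by linarith, by linarith, by linarith, by linarith, by linarith, by linarith⟩

lemma logSum_chiSix_one_le (j : ℕ) :
    logSum chiSix (6 * j + 1) ≤ 1 / 3 * Real.log (6 * j + 1) := by
  induction j with
  | zero => norm_num [logSum_chiSix_succ]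
  | succ j ih =>
    rw [show 6 * (j + 1) + 1 = 6 * j + 7 by ring, (logSum_chiSix_block j).2.1]
    have h := Real.log_le_log (x := (6 * (j : ℝ) + 7) ^ 2 * (6 * j + 1))
      (y := (6 * (j : ℝ) + 5) ^ 3) (by positivity) (by
        have : (0 : ℝ) ≤ j := Nat.cast_nonneg j
        nlinarith)
    rw [Real.log_mul (by positivity) (by positivity), Real.log_pow, Real.log_pow] at h
    push_cast at *
    rw [show 6 * ((j : ℝ) + 1) + 1 = 6 * j + 7 by ring]
    linarith

lemma logSum_chiSix_five_le (j : ℕ) : logSum chiSix (6 * j + 5) ≤ 0 := by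
  rw [(logSum_chiSix_block j).1]
  have h1 := logSum_chiSix_one_le j
  have h2 := Real.log_le_log (x := 6 * (j : ℝ) + 1) (y := 6 * j + 5) (by positivity) (by linarith)
  have h3 : 0 ≤ Real.log (6 * (j : ℝ) + 1) :=
    Real.log_nonneg (by have : (0 : ℝ) ≤ j := Nat.cast_nonneg j
                        linarith)
  linarith

lemma logSum_chiSix_ge_five (j : ℕ) :
    -Real.log (6 * j + 5) ≤ logSum chiSix (6 * j + 5) ∧ 0 ≤ logSum chiSix (6 * j + 7) := by
  have key : ∀ j : ℕ, -Real.log (6 * j + 5) ≤ logSum chiSix (6 * j + 5) →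
      0 ≤ logSum chiSix (6 * j + 7) := by
    intro j hj
    have h2 := Real.log_le_log (x := 6 * (j : ℝ) + 5) (y := 6 * j + 7) (by positivity) (by linarith)
    rw [(logSum_chiSix_block j).2.1, ← (logSum_chiSix_block j).1]
    linarith
  have main : ∀ j : ℕ, -Real.log (6 * j + 5) ≤ logSum chiSix (6 * j + 5) := by
    intro j
    induction j with
    | zero => norm_num [logSum_chiSix_succ]
    | succ j ih =>
      rw [(logSum_chiSix_block (j + 1)).1]
      have := key j ih
      rw [show 6 * (j + 1) + 1 = 6 * j + 7 by ring]
      push_cast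
      linarith
  exact ⟨main j, key j (main j)⟩

lemma logSum_chiSix_le {y : ℕ} (hy : 0 < y) :
    logSum chiSix y ≤ 1 / 3 * Real.log y ∧ (y < 7 → logSum chiSix y ≤ 0) := by
  have hpos : 0 ≤ 1 / 3 * Real.log (y : ℝ) := by
    have : (1 : ℝ) ≤ y := by exact_mod_cast hy
    have := Real.log_nonneg this
    linarith
  obtain ⟨h1, h2, h3, h4, h5, h6⟩ := logSum_chiSix_block ((y - 1) / 6)
  have h7 := logSum_chiSix_five_le ((y - 1) / 6)
  have h8 := logSum_chiSix_one_le ((y - 1) / 6)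
  set j := (y - 1) / 6 with hj
  have hle : 1 / 3 * Real.log (6 * j + 1) ≤ 1 / 3 * Real.log y := by
    refine mul_le_mul_of_nonneg_left (Real.log_le_log (by positivity) ?_) (by norm_num)
    exact_mod_cast (show 6 * j + 1 ≤ y by omega)
  have hsmall : y < 7 → 1 / 3 * Real.log (6 * (j : ℝ) + 1) ≤ 0 := by
    intro h
    have : j = 0 := by omega
    rw [this]; norm_num
  have hc : y = 6 * j + 1 ∨ y = 6 * j + 2 ∨ y = 6 * j + 3 ∨ y = 6 * j + 4 ∨ y = 6 * j + 5 ∨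
      y = 6 * j + 6 := by omega
  have : logSum chiSix y ≤ 1 / 3 * Real.log (6 * j + 1) ∨ logSum chiSix y ≤ 0 := by
    rcases hc with h | h | h | h | h | h <;> rw [h]
    · exact Or.inl h8
    · exact Or.inl (h3 ▸ h8)
    · exact Or.inl (h4 ▸ h8)
    · exact Or.inl (h5 ▸ h8)
    · exact Or.inr h7
    · exact Or.inr (h6 ▸ h7)
  rcases this with h | h
  · exact ⟨h.trans hle, fun hy => h.trans (hsmall hy)⟩
  · exact ⟨h.trans hpos, fun _ => h⟩

lemma logSum_chiSix_ge {y : ℕ} (hy : 0 < y) :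
    -Real.log y ≤ logSum chiSix y ∧ (y < 5 → 0 ≤ logSum chiSix y) := by
  have hpos : 0 ≤ Real.log (y : ℝ) := Real.log_nonneg (by exact_mod_cast hy)
  obtain ⟨h1, h2, h3, h4, h5, h6⟩ := logSum_chiSix_block ((y - 1) / 6)
  have h7 := (logSum_chiSix_ge_five ((y - 1) / 6)).1
  have h8 : 0 ≤ logSum chiSix (6 * ((y - 1) / 6) + 1) := by
    cases (y - 1) / 6 with
    | zero => norm_num [logSum_chiSix_succ]
    | succ i => exact (logSum_chiSix_ge_five i).2
  set j := (y - 1) / 6 with hj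
  have hc : y = 6 * j + 1 ∨ y = 6 * j + 2 ∨ y = 6 * j + 3 ∨ y = 6 * j + 4 ∨
      y = 6 * j + 5 ∨ y = 6 * j + 6 := by omega
  have : 0 ≤ logSum chiSix y ∨ (6 * j + 5 ≤ y ∧ -Real.log (6 * j + 5) ≤ logSum chiSix y) := by
    rcases hc with h | h | h | h | h | h
    · exact Or.inl (h ▸ h8)
    · exact Or.inl (by rw [h, h3]; exact h8)
    · exact Or.inl (by rw [h, h4]; exact h8)
    · exact Or.inl (by rw [h, ‹logSum chiSix (6 * j + 4) = _›]; exact h8)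
    · exact Or.inr ⟨h.ge, by rw [h]; exact h7⟩
    · exact Or.inr ⟨by omega, by rw [h, h6]; exact h7⟩
  rcases this with h | ⟨h, h'⟩
  · exact ⟨by linarith, fun _ => h⟩
  · refine ⟨le_trans (neg_le_neg (Real.log_le_log (by positivity) ?_)) h',
      fun h5 => absurd h5 (by omega)⟩
    exact_mod_cast h

lemma logSum_chiTwelve_succ (N : ℕ) : logSum chiTwelve (N + 1) = logSum chiTwelve N +
    (if (N + 1) % 12 = 1 ∨ (N + 1) % 12 = 5 then 1 else
      if (N + 1) % 12 = 7 ∨ (N + 1) % 12 = 11 then -1 else 0) * Real.log (N + 1) := by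
  rw [logSum_succ, chiTwelve_apply]

/-- Uniform upper bounds over one period, in terms of the value at the start of the period. -/
lemma logSum_chiTwelve_le (j : ℕ) :
    logSum chiTwelve (12 * j + 5) ≤ Real.log (12 * j + 5) ∧
      ∀ i < 12, logSum chiTwelve (12 * j + 5 + i) ≤ Real.log (12 * j + 5 + i) := by
  have z : ∀ N : ℕ, N % 12 ≠ 0 → N % 12 ≠ 4 → N % 12 ≠ 6 → N % 12 ≠ 10 →
      logSum chiTwelve (N + 1) = logSum chiTwelve N := by
    intro N _ _ _ _
    rw [logSum_chiTwelve_succ, if_neg (by omega), if_neg (by omega)]; ring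
  have e6 (j : ℕ) := z (12 * j + 5) (by omega) (by omega) (by omega) (by omega)
  have e7 (j : ℕ) : logSum chiTwelve (12 * j + 7) =
      logSum chiTwelve (12 * j + 5) - Real.log (12 * j + 7) := by
    rw [logSum_chiTwelve_succ, if_neg (by omega), if_pos (by omega), e6]; push_cast; ring_nf
  have e8 (j : ℕ) := z (12 * j + 7) (by omega) (by omega) (by omega) (by omega)
  have e9 (j : ℕ) := z (12 * j + 8) (by omega) (by omega) (by omega) (by omega)
  have e10 (j : ℕ) := z (12 * j + 9) (by omega) (by omega) (by omega) (by omega)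
  have e11 (j : ℕ) : logSum chiTwelve (12 * j + 11) =
      logSum chiTwelve (12 * j + 7) - Real.log (12 * j + 11) := by
    rw [logSum_chiTwelve_succ, if_neg (by omega), if_pos (by omega), e10, e9, e8]
    push_cast; ring_nf
  have e12 (j : ℕ) := z (12 * j + 11) (by omega) (by omega) (by omega) (by omega)
  have e13 (j : ℕ) : logSum chiTwelve (12 * j + 13) =
      logSum chiTwelve (12 * j + 11) + Real.log (12 * j + 13) := by
    rw [logSum_chiTwelve_succ, if_pos (by omega), e12]; push_cast; ring_nf
  have e14 (j : ℕ) := z (12 * j + 13) (by omega) (by omega) (by omega) (by omega)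
  have e15 (j : ℕ) := z (12 * j + 14) (by omega) (by omega) (by omega) (by omega)
  have e16 (j : ℕ) := z (12 * j + 15) (by omega) (by omega) (by omega) (by omega)
  have e17 (j : ℕ) : logSum chiTwelve (12 * j + 17) =
      logSum chiTwelve (12 * j + 13) + Real.log (12 * j + 17) := by
    rw [logSum_chiTwelve_succ, if_pos (by omega), e16, e15, e14]; push_cast; ring_nf
  have main : ∀ j : ℕ, logSum chiTwelve (12 * j + 5) ≤ Real.log (12 * j + 5) := by
    intro j
    induction j with
    | zero => norm_num [logSum_chiTwelve_succ]
    | succ j ih =>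
      rw [show 12 * (j + 1) + 5 = 12 * j + 17 by ring, e17, e13, e11, e7]
      have h := Real.log_le_log (x := (12 * (j : ℝ) + 5) * (12 * j + 13))
        (y := (12 * (j : ℝ) + 7) * (12 * j + 11)) (by positivity) (by
          have : (0 : ℝ) ≤ j := Nat.cast_nonneg j
          nlinarith)
      rw [Real.log_mul (by positivity) (by positivity),
        Real.log_mul (by positivity) (by positivity)] at h
      push_cast
      rw [show 12 * ((j : ℝ) + 1) + 5 = 12 * j + 17 by ring]
      linarith
  refine ⟨main j, fun i hi => ?_⟩
  have h0 := main j
  have hj : (0 : ℝ) ≤ j := Nat.cast_nonneg j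
  have h7 : Real.log (12 * j + 5) ≤ Real.log (12 * j + 7) :=
    Real.log_le_log (by positivity) (by linarith)
  have h11 : 0 ≤ Real.log (12 * j + 11) := Real.log_nonneg (by linarith)
  have hi0 : Real.log (12 * j + 5) ≤ Real.log (12 * j + 5 + i) :=
    Real.log_le_log (by positivity) (by have : (0 : ℝ) ≤ i := Nat.cast_nonneg i
                                        linarith)
  have hi1 : 0 ≤ Real.log (12 * (j : ℝ) + 5) := Real.log_nonneg (by linarith)
  have hi2 : 8 ≤ i → Real.log (12 * j + 13) ≤ Real.log (12 * j + 5 + i) := by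
    intro h
    have : (8 : ℝ) ≤ i := by exact_mod_cast h
    exact Real.log_le_log (by positivity) (by linarith)
  have e7' := e7 j
  have e11' := e11 j
  have e13' := e13 j
  interval_cases i
  · simpa using h0
  · rw [show 12 * j + 5 + 1 = 12 * j + 6 by ring, e6]; linarith
  · rw [show 12 * j + 5 + 2 = 12 * j + 7 by ring]; linarith
  · rw [show 12 * j + 5 + 3 = 12 * j + 8 by ring, e8]; linarith
  · rw [show 12 * j + 5 + 4 = 12 * j + 9 by ring, e9, e8]; linarith
  · rw [show 12 * j + 5 + 5 = 12 * j + 10 by ring, e10, e9, e8]; linarith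
  · rw [show 12 * j + 5 + 6 = 12 * j + 11 by ring]; linarith
  · rw [show 12 * j + 5 + 7 = 12 * j + 12 by ring, e12]; linarith
  · have := hi2 (by norm_num)
    rw [show 12 * j + 5 + 8 = 12 * j + 13 by ring]; linarith
  · have := hi2 (by norm_num)
    rw [show 12 * j + 5 + 9 = 12 * j + 14 by ring, e14]; linarith
  · have := hi2 (by norm_num)
    rw [show 12 * j + 5 + 10 = 12 * j + 15 by ring, e15, e14]; linarith
  · have := hi2 (by norm_num)
    rw [show 12 * j + 5 + 11 = 12 * j + 16 by ring, e16, e15, e14]; linarith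

lemma logSum_chiTwelve_le_log {y : ℕ} (hy : 5 ≤ y) : logSum chiTwelve y ≤ Real.log y := by
  have h := (logSum_chiTwelve_le ((y - 5) / 12)).2 ((y - 5) % 12) (Nat.mod_lt _ (by norm_num))
  have e : y = 12 * ((y - 5) / 12) + 5 + (y - 5) % 12 := by omega
  have e' : (y : ℝ) = 12 * ((y - 5) / 12 : ℕ) + 5 + ((y - 5) % 12 : ℕ) := by exact_mod_cast e
  rw [← e, ← e'] at h
  exact h

lemma logSum_chiTwelve_of_lt {y : ℕ} (hy : y < 5) : logSum chiTwelve y = 0 := by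
  interval_cases y <;> norm_num [logSum_chiTwelve_succ]

lemma vonMangoldt_mul_le {f g : ℕ → ℝ}
    (h : ∀ p k, p.Prime → k ≠ 0 → f (p ^ k) ≤ g (p ^ k)) (q : ℕ) :
    f q * vonMangoldt q ≤ g q * vonMangoldt q := by
  by_cases hq : IsPrimePow q
  · obtain ⟨p, k, hp, hk, rfl⟩ := hq
    exact mul_le_mul_of_nonneg_right (h p k hp.nat_prime hk.ne') vonMangoldt_nonneg
  · rw [vonMangoldt_eq_zero_iff.2 hq]; simp

lemma prime_pow_mod_eq_zero_iff {p r k : ℕ} (hp : p.Prime) (hr : r.Prime) (hk : k ≠ 0) :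
    p ^ k % r = 0 ↔ p = r := by
  rw [← Nat.dvd_iff_mod_eq_zero]
  refine ⟨fun h => ((Nat.prime_dvd_prime_iff_eq hr hp).1 (hr.dvd_of_dvd_pow h)).symm, ?_⟩
  rintro rfl
  exact dvd_pow_self _ hk

/-- The indicator of being coprime to `6`. -/
noncomputable def coprimeSix (n : ℕ) : ℝ := if n % 2 ≠ 0 ∧ n % 3 ≠ 0 then 1 else 0

lemma mangoldtSix_eq (n : ℕ) : mangoldtSix n = coprimeSix n * vonMangoldt n := by
  rw [mangoldtSix_apply, coprimeSix]; split_ifs <;> simp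

lemma coprimeSix_prime_pow {p k : ℕ} (hp : p.Prime) (hk : k ≠ 0) :
    coprimeSix (p ^ k) = if p = 2 ∨ p = 3 then 0 else 1 := by
  simp only [coprimeSix, ne_eq, prime_pow_mod_eq_zero_iff hp Nat.prime_two hk,
    prime_pow_mod_eq_zero_iff hp Nat.prime_three hk]
  split_ifs <;> tauto

lemma prime_mod_two {p : ℕ} (hp : p.Prime) : p = 2 ∨ p % 2 = 1 := hp.eq_two_or_odd

lemma prime_mod_three {p : ℕ} (hp : p.Prime) : p = 3 ∨ p % 3 ≠ 0 := by
  by_cases h : p % 3 = 0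
  · exact Or.inl ((Nat.prime_dvd_prime_iff_eq Nat.prime_three hp).1
      (Nat.dvd_of_mod_eq_zero h)).symm
  · exact Or.inr h

lemma neg_one_pow_eq (k : ℕ) : (-1 : ℝ) ^ k = if k % 2 = 0 then 1 else -1 := by
  split_ifs with h
  · exact (Nat.even_iff.2 h).neg_one_pow
  · exact (Nat.odd_iff.2 (by omega)).neg_one_pow

/-- All prime factors are congruent to `a` modulo `d`. -/
def PrimesMod (d a q k : ℕ) : Prop := k = 0 ∨ q % d = a

/-- Odd integers in which primes congruent to `3` modulo `4` have even exponents. -/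
def EvenModFour (q k : ℕ) : Prop := (q % 4 = 3 → k % 2 = 0) ∧ (q % 2 = 0 → k = 0)

/-- Integers coprime to `3` in which odd primes congruent to `2` modulo `3` have even exponents. -/
def EvenModThree (q k : ℕ) : Prop := (q % 6 = 5 → k % 2 = 0) ∧ (q % 3 = 0 → k = 0)

/-- Squarefree integers composed of odd primes congruent to `2` modulo `3`. -/
def SquarefreeModThree (q k : ℕ) : Prop := k = 0 ∨ (k = 1 ∧ q % 6 = 5)

/-- Squarefree integers composed of primes congruent to `7` or `11` modulo `12`. -/
def SquarefreeModFour (q k : ℕ) : Prop := k = 0 ∨ (k = 1 ∧ (q % 12 = 7 ∨ q % 12 = 11))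

lemma locInd_primesMod_mul_chiFour :
    locInd (PrimesMod 4 3) * toArith chiFour = locInd EvenModFour := by
  refine locInd_mul_toArith _ (fun q => Or.inl rfl) (fun q => ⟨fun _ => rfl, fun _ => rfl⟩)
    fun p hp k => ?_
  have h2 := prime_mod_two hp
  rw [chiFour_apply]
  unfold PrimesMod EvenModFour
  split_ifs <;> first | (exfalso; omega) | (norm_num; done) | (simp_all <;> omega)

lemma locInd_primesMod_mul_chiSix :
    locInd (PrimesMod 3 2) * toArith chiSix = locInd EvenModThree := by
  refine locInd_mul_toArith _ (fun q => Or.inl rfl) (fun q => ⟨fun _ => rfl, fun _ => rfl⟩)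
    fun p hp k => ?_
  have h2 := prime_mod_two hp
  have h3 := prime_mod_three hp
  rw [chiSix_apply]
  unfold PrimesMod EvenModThree
  split_ifs <;> first | (exfalso; omega) | (norm_num; done) | (simp_all <;> omega)

lemma locInd_squarefree_mul_chiSix :
    locInd SquarefreeModThree * toArith chiSix = locInd (PrimesMod 3 1) := by
  refine locInd_mul_toArith _ (fun q => Or.inl rfl) (fun q => Or.inl rfl) fun p hp k => ?_
  have h2 := prime_mod_two hp
  have h3 := prime_mod_three hp
  rw [chiSix_apply]
  unfold PrimesMod SquarefreeModThree
  split_ifs <;> first | (exfalso; omega) | (norm_num; done) | (simp_all <;> omega)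

lemma locInd_squarefree_mul_chiTwelve :
    locInd SquarefreeModFour * toArith chiTwelve = locInd (PrimesMod 4 1) := by
  refine locInd_mul_toArith _ (fun q => Or.inl rfl) (fun q => Or.inl rfl) fun p hp k => ?_
  have h2 := prime_mod_two hp
  have h3 := prime_mod_three hp
  rw [chiTwelve_apply]
  unfold PrimesMod SquarefreeModFour
  split_ifs <;> first | (exfalso; omega) | (norm_num; done) | (simp_all <;> omega)

/-- The von Mangoldt function restricted to the powers of `3`. -/
noncomputable def mangoldtThree : ArithmeticFunction ℝ :=
  ⟨fun n => if n % 3 = 0 then vonMangoldt n else 0, by simp⟩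

lemma mangoldtThree_apply (n : ℕ) :
    mangoldtThree n = if n % 3 = 0 then vonMangoldt n else 0 := rfl

lemma mangoldtThree_nonneg (n : ℕ) : 0 ≤ mangoldtThree n := by
  rw [mangoldtThree_apply]; split_ifs <;> simp

lemma mangoldt_le_evenModFour (q : ℕ) :
    mangoldtSix q + mangoldtThree q + chiFour q * vonMangoldt q ≤
      2 * (locInd EvenModFour q * vonMangoldt q) := by
  have h := vonMangoldt_mul_le
    (f := fun n => coprimeSix n + (if n % 3 = 0 then 1 else 0) + chiFour n)
    (g := fun n => 2 * locInd EvenModFour n) (fun p k hp hk => ?_) q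
  · rw [mangoldtSix_eq, mangoldtThree_apply]
    simp only [add_mul, ite_mul, one_mul, zero_mul] at h
    linarith
  · simp only [prime_pow_mod_eq_zero_iff hp Nat.prime_three hk]
    rw [coprimeSix_prime_pow hp hk, map_pow chiFour,
      locInd_prime_pow (fun q => ⟨fun _ => rfl, fun _ => rfl⟩) hp, chiFour_apply]
    have h2 := prime_mod_two hp
    have hz : (0 : ℝ) ^ k = 0 := zero_pow hk
    unfold EvenModFour
    split_ifs <;> first | (exfalso; omega) | (simp only [hz, one_pow]; norm_num; done) |
      (simp only [neg_one_pow_eq]; split_ifs <;> first | (exfalso; omega) | norm_num)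

lemma mangoldt_le_evenModThree (q : ℕ) :
    mangoldtSix q + (0 : ArithmeticFunction ℝ) q + chiSix q * vonMangoldt q ≤
      2 * (locInd EvenModThree q * vonMangoldt q) := by
  have h := vonMangoldt_mul_le (f := fun n => coprimeSix n + chiSix n)
    (g := fun n => 2 * locInd EvenModThree n) (fun p k hp hk => ?_) q
  · rw [mangoldtSix_eq, ArithmeticFunction.zero_apply]
    simp only [add_mul] at h
    linarith
  · rw [coprimeSix_prime_pow hp hk, map_pow,
      locInd_prime_pow (fun q => ⟨fun _ => rfl, fun _ => rfl⟩) hp, chiSix_apply]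
    have h2 := prime_mod_two hp
    have h3 := prime_mod_three hp
    have hz : (0 : ℝ) ^ k = 0 := zero_pow hk
    unfold EvenModThree
    split_ifs <;> first | (exfalso; omega) | (simp only [hz, one_pow]; norm_num; done) |
      (simp only [neg_one_pow_eq]; split_ifs <;> first | (exfalso; omega) | norm_num)

lemma primesMod_three_le_mangoldt (q : ℕ) :
    2 * (locInd (PrimesMod 3 1) q * vonMangoldt q) ≤ mangoldtSix q + chiSix q * vonMangoldt q := by
  have h := vonMangoldt_mul_le (f := fun n => 2 * locInd (PrimesMod 3 1) n)
    (g := fun n => coprimeSix n + chiSix n) (fun p k hp hk => ?_) q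
  · rw [mangoldtSix_eq]
    simp only [add_mul] at h
    linarith
  · rw [coprimeSix_prime_pow hp hk, map_pow chiSix, locInd_prime_pow (fun q => Or.inl rfl) hp,
      chiSix_apply]
    have h2 := prime_mod_two hp
    have h3 := prime_mod_three hp
    have hz : (0 : ℝ) ^ k = 0 := zero_pow hk
    unfold PrimesMod
    split_ifs <;> first | (exfalso; omega) | (simp only [hz, one_pow]; norm_num; done) |
      (simp only [neg_one_pow_eq]; split_ifs <;> first | (exfalso; omega) | norm_num)

lemma primesMod_four_le_mangoldt (q : ℕ) :
    2 * (locInd (PrimesMod 4 1) q * vonMangoldt q) ≤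
      mangoldtSix q + chiTwelve q * vonMangoldt q := by
  have h := vonMangoldt_mul_le (f := fun n => 2 * locInd (PrimesMod 4 1) n)
    (g := fun n => coprimeSix n + chiTwelve n) (fun p k hp hk => ?_) q
  · rw [mangoldtSix_eq]
    simp only [add_mul] at h
    linarith
  · rw [coprimeSix_prime_pow hp hk, map_pow chiTwelve, locInd_prime_pow (fun q => Or.inl rfl) hp,
      chiTwelve_apply]
    have h2 := prime_mod_two hp
    have h3 := prime_mod_three hp
    have hz : (0 : ℝ) ^ k = 0 := zero_pow hk
    unfold PrimesMod
    split_ifs <;> first | (exfalso; omega) | (simp only [hz, one_pow]; norm_num; done) |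
      (simp only [neg_one_pow_eq]; split_ifs <;> first | (exfalso; omega) | norm_num)

lemma psum_le_of_odd {g : ArithmeticFunction ℝ} (h1 : ∀ n, g n ≤ 1)
    (h2 : ∀ n, n % 2 = 0 → g n ≤ 0) (M : ℕ) : psum g M ≤ 1 / 2 * M + 1 := by
  have key : psum g M ≤ ((M + 1) / 2 : ℕ) := by
    induction M with
    | zero => simp
    | succ M ih =>
      rw [psum_succ]
      rcases Nat.mod_two_eq_zero_or_one M with h | h
      · have := h1 (M + 1)
        rw [show (M + 1 + 1) / 2 = (M + 1) / 2 + 1 by omega]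
        push_cast
        linarith
      · have := h2 (M + 1) (by omega)
        rw [show (M + 1 + 1) / 2 = (M + 1) / 2 by omega]
        linarith
  have : (((M + 1) / 2 : ℕ) : ℝ) ≤ ((M + 1 : ℕ) : ℝ) / (2 : ℕ) := Nat.cast_div_le
  push_cast at this
  linarith

lemma psum_locInd_le (L : ℕ → ℕ → Prop) (M : ℕ) : psum (locInd L) M ≤ 1 * M + 1 := by
  have : psum (locInd L) M ≤ M := by
    refine (sum_le_sum fun n _ => locInd_le_one L n).trans ?_
    simp
  linarith

lemma psum_locInd_le_half {L : ℕ → ℕ → Prop} (hL : ∀ k, L 2 k → k = 0) (M : ℕ) :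
    psum (locInd L) M ≤ 1 / 2 * M + 1 := by
  refine psum_le_of_odd (locInd_le_one L) (fun n hn => ?_) M
  rw [locInd_apply, if_neg]
  rintro ⟨h0, h⟩
  have h1 := hL _ (h 2 Nat.prime_two)
  have h3 := Nat.prime_two.factorization_pos_of_dvd h0 (Nat.dvd_of_mod_eq_zero hn)
  omega

lemma psum_mangoldtThree_ge {y : ℕ} (hy : 3 ≤ y) :
    Real.log 3 ≤ psum (mangoldtThree * toArith chiFour) y := by
  rw [psum_mul]
  have hk : Nat.log 3 y ≠ 0 := (Nat.log_pos (by norm_num) hy).ne'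
  have hle : 3 ^ Nat.log 3 y ≤ y := Nat.pow_log_le_self 3 (by omega)
  have hlt : y < 3 ^ Nat.log 3 y * 3 := by
    rw [← pow_succ]; exact Nat.lt_pow_succ_log_self (by norm_num) y
  have h := single_le_sum (f := fun n => mangoldtThree n * psum (toArith chiFour) (y / n))
    (s := Ioc 0 y) (a := 3 ^ Nat.log 3 y) (fun n _ => mul_nonneg (mangoldtThree_nonneg n) (by
      rw [psum_chiFour]; split_ifs <;> norm_num)) (mem_Ioc.2 ⟨by positivity, hle⟩)
  refine le_trans (le_of_eq ?_) h
  have h1 : 1 ≤ y / 3 ^ Nat.log 3 y := (Nat.one_le_div_iff (by positivity)).2 hle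
  have h2 : y / 3 ^ Nat.log 3 y < 3 := Nat.div_lt_of_lt_mul hlt
  simp only [mangoldtThree_apply, psum_chiFour,
    prime_pow_mod_eq_zero_iff Nat.prime_three Nat.prime_three hk,
    vonMangoldt_apply_pow hk, vonMangoldt_apply_prime Nat.prime_three, if_true]
  rw [if_pos (by omega)]
  norm_num

lemma psum_mangoldtThree_add_logSum_ge (y : ℕ) :
    (y < 7 → 0 ≤ psum (mangoldtThree * toArith chiFour + pmul (toArith chiFour) log) y) ∧
      (7 ≤ y → -(1 / 2 * Real.log (y / 3)) ≤
        psum (mangoldtThree * toArith chiFour + pmul (toArith chiFour) log) y) := by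
  have e : psum (mangoldtThree * toArith chiFour + pmul (toArith chiFour) log) y =
      psum (mangoldtThree * toArith chiFour) y + logSum chiFour y := psum_add _ _ _
  rw [e]
  rcases Nat.lt_or_ge y 3 with h | h
  · refine ⟨fun _ => ?_, fun h' => by omega⟩
    have h1 : 0 ≤ psum (mangoldtThree * toArith chiFour) y := by
      rw [psum_mul]
      refine sum_nonneg fun n _ => mul_nonneg (mangoldtThree_nonneg n) ?_
      rw [psum_chiFour]
      split_ifs <;> norm_num
    have h2 : logSum chiFour y = 0 := by interval_cases y <;> simp [logSum_chiFour_succ]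
    linarith
  · have h3 := psum_mangoldtThree_ge h
    refine ⟨fun h7 => ?_, fun h7 => ?_⟩
    · obtain ⟨h4, h5, h6, h8⟩ := logSum_chiFour_add_three 0
      have h9 : Real.log 9 = 2 * Real.log 3 := by
        rw [show (9 : ℝ) = 3 ^ 2 by norm_num, Real.log_pow]; norm_num
      norm_num [h9] at h4 h5 h6 h8
      have := Real.log_nonneg (show (1 : ℝ) ≤ 3 by norm_num)
      interval_cases y <;> linarith
    · have h4 := logSum_chiFour_ge h
      have hy : (0 : ℝ) < y := by exact_mod_cast (show 0 < y by omega)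
      rw [Real.log_mul (by norm_num) hy.ne'] at h4
      rw [Real.log_div hy.ne' (by norm_num)]
      linarith

lemma log_seven_le : Real.log 7 ≤ 17 / 6 * 0.69315 := by
  have h := Real.log_le_log (x := (7 : ℝ) ^ 6) (y := 2 ^ 17) (by norm_num) (by norm_num)
  rw [Real.log_pow, Real.log_pow] at h
  have := Real.log_two_lt_d9
  push_cast at h
  linarith

lemma log_five_le : Real.log 5 ≤ 7 / 3 * 0.69315 := by
  have h := Real.log_le_log (x := (5 : ℝ) ^ 3) (y := 2 ^ 7) (by norm_num) (by norm_num)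
  rw [Real.log_pow, Real.log_pow] at h
  have := Real.log_two_lt_d9
  push_cast at h
  linarith

lemma log_seven_div_three_le : Real.log (7 / 3) ≤ 5 / 4 * 0.69315 := by
  have h := Real.log_le_log (x := (7 / 3 : ℝ) ^ 4) (y := 2 ^ 5) (by norm_num) (by norm_num)
  rw [Real.log_pow, Real.log_pow] at h
  have := Real.log_two_lt_d9
  push_cast at h
  linarith

lemma arith_sub_apply (f g : ArithmeticFunction ℝ) (n : ℕ) : (f - g) n = f n - g n := by
  rw [sub_eq_add_neg, ArithmeticFunction.add_apply, sub_eq_add_neg]; rfl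

lemma psum_sub (f g : ArithmeticFunction ℝ) (N : ℕ) : psum (f - g) N = psum f N - psum g N := by
  simp [psum, arith_sub_apply]

lemma psum_nonneg_of_log_weighted {f : ArithmeticFunction ℝ} {N : ℕ} (hN : 1 < N)
    (h : ∀ m < N, 0 ≤ psum f m) (h' : 0 ≤ ∑ n ∈ Ioc 0 N, f n * Real.log n) : 0 ≤ psum f N :=
  nonneg_of_mul_nonneg_left (h'.trans (sum_mul_log_le h)) (Real.log_pos (by exact_mod_cast hN))

lemma cast_div_le_div (N d : ℕ) : ((N / d : ℕ) : ℝ) ≤ N / d := Nat.cast_div_le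

/-- Jumps of a step function below the difference of the counting functions of `EvenModFour` and
`PrimesMod 3 1`. -/
def stepsFour : List (ℕ × ℕ) :=
  [(9, 1), (25, 1), (45, 1), (85, 2), (117, 2), (173, 2), (233, 2), (289, 3), (389, 4), (533, 6)]

/-- Jumps of a step function below the difference of the counting functions of `EvenModThree` and
`PrimesMod 4 1`. -/
def stepsThree : List (ℕ × ℕ) :=
  [(2, 1), (7, 1), (8, 1), (14, 1), (19, 1), (32, 3), (50, 3), (76, 5), (163, 14), (344, 26)]

lemma evenModFour_sub_primesMod_nonneg {N : ℕ}
    (hN : 14000 < N)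
    (h : ∀ m < N, 0 ≤ psum (locInd EvenModFour) m - psum (locInd (PrimesMod 3 1)) m)
    (hK : ∀ n, 0 < n → n ≤ 14000 →
      stepFun stepsFour n ≤ psum (locInd EvenModFour) n - psum (locInd (PrimesMod 3 1)) n) :
    0 ≤ psum (locInd EvenModFour) N - psum (locInd (PrimesMod 3 1)) N := by
  simp only [← psum_sub] at h ⊢
  refine psum_nonneg_of_log_weighted (by omega) h ?_
  have hD := sum_mangoldtSix_ge (l := stepsFour) (by decide) (N := N)
    (fun n hn => (psum_sub _ _ _).symm ▸ h n hn) hK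
  have hM := log_weighted_ge (T := EvenModFour) (A := PrimesMod 3 1)
    (fun q i j hi hj => by unfold EvenModFour at *; omega)
    (fun q i j hij hj => by unfold PrimesMod at *; omega)
    locInd_primesMod_mul_chiFour locInd_squarefree_mul_chiSix mangoldt_le_evenModFour
    primesMod_three_le_mangoldt N
  have hU := sum_mul_div_ge (g := locInd (PrimesMod 4 3)) (α := 1 / 2) (locInd_nonneg _)
    (psum_locInd_le_half fun k hk => by unfold PrimesMod at hk; omega) (by norm_num)
    (H := fun y => psum (mangoldtThree * toArith chiFour + pmul (toArith chiFour) log) y)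
    (c := 3) (lam := 1 / 2) (y₀ := 7) (by norm_num) (by norm_num) (by norm_num)
    (fun y hy => (psum_mangoldtThree_add_logSum_ge y).1 hy)
    (fun y hy => (psum_mangoldtThree_add_logSum_ge y).2 hy) N
  have hV := sum_mul_div_ge (g := locInd SquarefreeModThree) (α := 1 / 2) (locInd_nonneg _)
    (psum_locInd_le_half fun k hk => by unfold SquarefreeModThree at hk; omega) (by norm_num)
    (H := fun y => -logSum chiSix y) (c := 1) (lam := 1 / 3) (y₀ := 7) (by norm_num) (by norm_num)
    (by norm_num) (fun y hy => ?_) (fun y hy => ?_) N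
  rotate_left
  · rcases Nat.eq_zero_or_pos y with rfl | h0
    · simp
    · exact neg_nonneg.2 ((logSum_chiSix_le h0).2 hy)
  · rw [div_one]
    exact neg_le_neg (logSum_chiSix_le (by omega)).1
  have hMN := cast_div_le_div N 7
  have hlog := log_le_div_two_pow_add (z := (N / 7 : ℕ) + 1) (by positivity) 11
  have a1 := mul_le_mul_of_nonneg_right log_seven_div_three_le
    (show (0 : ℝ) ≤ 1 / 2 * (N / 7 : ℕ) + 1 by positivity)
  have a2 := mul_le_mul_of_nonneg_right log_seven_le
    (show (0 : ℝ) ≤ 1 / 2 * (N / 7 : ℕ) + 1 by positivity)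
  have hK' := psum_mangoldtSix_le (N / 14001)
  have hKN := cast_div_le_div N 14001
  have e9 := psum_mangoldtSix_div_ge (N := N) (y := 9) (by norm_num) (by omega) 11
  have e25 := psum_mangoldtSix_div_ge (N := N) (y := 25) (by norm_num) (by omega) 9
  have e45 := psum_mangoldtSix_div_ge (N := N) (y := 45) (by norm_num) (by omega) 8
  have e85 := psum_mangoldtSix_div_ge (N := N) (y := 85) (by norm_num) (by omega) 7
  have e117 := psum_mangoldtSix_div_ge (N := N) (y := 117) (by norm_num) (by omega) 7
  have e173 := psum_mangoldtSix_div_ge (N := N) (y := 173) (by norm_num) (by omega) 6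
  have e233 := psum_mangoldtSix_div_ge (N := N) (y := 233) (by norm_num) (by omega) 6
  have e289 := psum_mangoldtSix_div_ge (N := N) (y := 289) (by norm_num) (by omega) 6
  have e389 := psum_mangoldtSix_div_ge (N := N) (y := 389) (by norm_num) (by omega) 5
  have e533 := psum_mangoldtSix_div_ge (N := N) (y := 533) (by norm_num) (by omega) 5
  simp only [stepsFour, List.map_cons, List.map_nil, List.sum_cons, List.sum_nil] at hD
  simp only [logSum] at hV
  simp only [arith_sub_apply]
  norm_num at *
  have hN' : (14001 : ℝ) ≤ N := by exact_mod_cast hN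
  linarith

lemma evenModThree_sub_primesMod_nonneg {N : ℕ}
    (hN : 14000 < N)
    (h : ∀ m < N, 0 ≤ psum (locInd EvenModThree) m - psum (locInd (PrimesMod 4 1)) m)
    (hK : ∀ n, 0 < n → n ≤ 14000 →
      stepFun stepsThree n ≤ psum (locInd EvenModThree) n - psum (locInd (PrimesMod 4 1)) n) :
    0 ≤ psum (locInd EvenModThree) N - psum (locInd (PrimesMod 4 1)) N := by
  simp only [← psum_sub] at h ⊢
  refine psum_nonneg_of_log_weighted (by omega) h ?_
  have hD := sum_mangoldtSix_ge (l := stepsThree) (by decide) (N := N)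
    (fun n hn => (psum_sub _ _ _).symm ▸ h n hn) hK
  have hM := log_weighted_ge (T := EvenModThree) (A := PrimesMod 4 1)
    (fun q i j hi hj => by unfold EvenModThree at *; omega)
    (fun q i j hij hj => by unfold PrimesMod at *; omega)
    locInd_primesMod_mul_chiSix locInd_squarefree_mul_chiTwelve mangoldt_le_evenModThree
    primesMod_four_le_mangoldt N
  have hU := sum_mul_div_ge (g := locInd (PrimesMod 3 2)) (α := 1) (locInd_nonneg _)
    (psum_locInd_le _) (by norm_num)
    (H := fun y => logSum chiSix y) (c := 1) (lam := 1) (y₀ := 5) (by norm_num) (by norm_num)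
    (by norm_num) (fun y hy => ?_) (fun y hy => ?_) N
  rotate_left
  · rcases Nat.eq_zero_or_pos y with rfl | h0
    · simp
    · exact (logSum_chiSix_ge h0).2 hy
  · rw [div_one, one_mul]
    exact (logSum_chiSix_ge (by omega)).1
  have hV := sum_mul_div_ge (g := locInd SquarefreeModFour) (α := 1 / 2) (locInd_nonneg _)
    (psum_locInd_le_half fun k hk => by unfold SquarefreeModFour at hk; omega) (by norm_num)
    (H := fun y => -logSum chiTwelve y) (c := 1) (lam := 1) (y₀ := 5) (by norm_num) (by norm_num)
    (by norm_num) (fun y hy => ?_) (fun y hy => ?_) N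
  rotate_left
  · rw [logSum_chiTwelve_of_lt hy, neg_zero]
  · rw [div_one, one_mul]
    exact neg_le_neg (logSum_chiTwelve_le_log hy)
  have hMN := cast_div_le_div N 5
  have hlog := log_le_div_two_pow_add (z := (N / 5 : ℕ) + 1) (by positivity) 11
  have a1 := mul_le_mul_of_nonneg_right log_five_le
    (show (0 : ℝ) ≤ (N / 5 : ℕ) + 1 by positivity)
  have a2 := mul_le_mul_of_nonneg_right log_five_le
    (show (0 : ℝ) ≤ 1 / 2 * (N / 5 : ℕ) + 1 by positivity)
  have hK' := psum_mangoldtSix_le (N / 14001)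
  have hKN := cast_div_le_div N 14001
  have e2 := psum_mangoldtSix_div_ge (N := N) (y := 2) (by norm_num) (by omega) 13
  have e7 := psum_mangoldtSix_div_ge (N := N) (y := 7) (by norm_num) (by omega) 11
  have e8 := psum_mangoldtSix_div_ge (N := N) (y := 8) (by norm_num) (by omega) 11
  have e14 := psum_mangoldtSix_div_ge (N := N) (y := 14) (by norm_num) (by omega) 10
  have e19 := psum_mangoldtSix_div_ge (N := N) (y := 19) (by norm_num) (by omega) 10
  have e32 := psum_mangoldtSix_div_ge (N := N) (y := 32) (by norm_num) (by omega) 9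
  have e50 := psum_mangoldtSix_div_ge (N := N) (y := 50) (by norm_num) (by omega) 8
  have e76 := psum_mangoldtSix_div_ge (N := N) (y := 76) (by norm_num) (by omega) 8
  have e163 := psum_mangoldtSix_div_ge (N := N) (y := 163) (by norm_num) (by omega) 6
  have e344 := psum_mangoldtSix_div_ge (N := N) (y := 344) (by norm_num) (by omega) 5
  simp only [stepsThree, List.map_cons, List.map_nil, List.sum_cons, List.sum_nil] at hD
  simp only [logSum] at hU hV
  simp only [zero_mul, zero_add] at hM
  simp only [arith_sub_apply]
  norm_num at *
  have hN' : (14001 : ℝ) ≤ N := by exact_mod_cast hN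
  linarith

/-- Application of a function to a natural number which is evaluated first. -/
noncomputable def force {α : Type} (n : ℕ) (k : ℕ → α) : α :=
  Nat.rec (k 0) (fun m _ => k (Nat.succ m)) n

lemma force_eq {α : Type} (n : ℕ) (k : ℕ → α) : force n k = k n := by cases n <;> rfl

/-- The conditional, in terms of the recursor. -/
noncomputable def ifb {α : Type} (b : Bool) (x y : α) : α := Bool.rec y x b

@[simp] lemma ifb_eq {α : Type} (b : Bool) (x y : α) : ifb b x y = if b = true then x else y := by
  cases b <;> rfl

/-- Trial division of `n` by the primes in a list, accepting prime factors satisfying `fr` and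
squares of prime factors satisfying `sq`. -/
noncomputable def trial (fr sq : ℕ → Bool) (fuel : ℕ) : ℕ → List ℕ → Bool :=
  Nat.rec (fun _ _ => false) (fun _ ih n l =>
    List.rec (ifb (Nat.beq n 1) true (fr n)) (fun d l' _ =>
      ifb (Nat.ble (Nat.mul d d) n)
        (ifb (Nat.beq (Nat.mod n d) 0)
          (ifb (fr d) (force (Nat.div n d) fun m => ih m l)
            (ifb (sq d) (force (Nat.div n d) fun m =>
              ifb (Nat.beq (Nat.mod m d) 0) (force (Nat.div m d) fun m => ih m l) false) false))
          (ih n l'))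
        (ifb (Nat.beq n 1) true (fr n))) l) fuel

lemma trial_nil (fr sq : ℕ → Bool) (f n : ℕ) :
    trial fr sq (f + 1) n [] = if n = 1 then true else fr n := by
  change ifb (Nat.beq n 1) true (fr n) = _
  simp [Nat.beq_eq]

lemma trial_cons (fr sq : ℕ → Bool) (f n d : ℕ) (l : List ℕ) :
    trial fr sq (f + 1) n (d :: l) =
      if d * d ≤ n then
        if n % d = 0 then
          if fr d = true then trial fr sq f (n / d) (d :: l)
          else if sq d = true then
            if n / d % d = 0 then trial fr sq f (n / d / d) (d :: l) else false
          else false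
        else trial fr sq f n l
      else if n = 1 then true else fr n := by
  change ifb (Nat.ble (d * d) n) (ifb (Nat.beq (n % d) 0) (ifb (fr d)
    (force (n / d) fun m => trial fr sq f m (d :: l)) (ifb (sq d) (force (n / d) fun m =>
      ifb (Nat.beq (m % d) 0) (force (m / d) fun m => trial fr sq f m (d :: l)) false) false))
      (trial fr sq f n l)) (ifb (Nat.beq n 1) true (fr n)) = _
  simp only [force_eq, ifb_eq, Nat.ble_eq, Nat.beq_eq]

lemma eq_one_or_prime {n d : ℕ} (h0 : n ≠ 0) (hd : ∀ p, p.Prime → p ∣ n → d ≤ p)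
    (hn : n < d * d) : n = 1 ∨ n.Prime := by
  by_contra! h
  have h1 := Nat.minFac_sq_le_self (Nat.pos_of_ne_zero h0) h.2
  have h2 := hd _ (Nat.minFac_prime h.1) (Nat.minFac_dvd n)
  nlinarith

lemma locInd_one {L : ℕ → ℕ → Prop} (h0 : ∀ q, L q 0) : locInd L 1 = 1 :=
  (locInd_isMultiplicative h0).map_one

lemma locInd_eq_one_of_trial {L : ℕ → ℕ → Prop} (h0 : ∀ q, L q 0)
    (hL : ∀ q i j, L q i → L q j → L q (i + j)) {fr sq : ℕ → Bool}
    (hfr : ∀ p, fr p = true → L p 1) (hsq : ∀ p, sq p = true → L p 2) {B : ℕ} (f : ℕ) :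
    ∀ (l : List ℕ) (n : ℕ), l.Pairwise (· ≤ ·) → (∀ p ∈ l, p.Prime ∧ p ≤ B) → n ≠ 0 →
      n < B * B → (∀ p, p.Prime → p ∣ n → p ∈ l ∨ B ≤ p) → trial fr sq f n l = true →
      locInd L n = 1 := by
  have hprime : ∀ p, p.Prime → ∀ k, L p k → locInd L (p ^ k) = 1 := by
    intro p hp k hk
    rw [locInd_prime_pow h0 hp, if_pos hk]
  have hend : ∀ d n, n ≠ 0 → (∀ p, p.Prime → p ∣ n → d ≤ p) → n < d * d →
      (if n = 1 then true else fr n) = true → locInd L n = 1 := by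
    intro d n hn hd hlt h
    rcases eq_one_or_prime hn hd hlt with rfl | hp
    · exact locInd_one h0
    · rw [if_neg hp.ne_one] at h
      simpa using hprime n hp 1 (hfr n h)
  induction f with
  | zero => intro l n _ _ _ _ _ h; cases h
  | succ f ih =>
    intro l n hl hlp hn hB hdiv h
    cases l with
    | nil =>
      rw [trial_nil] at h
      exact hend B n hn (fun p hp hpn => by simpa using hdiv p hp hpn) hB h
    | cons d l =>
      have hd := hlp d List.mem_cons_self
      have hstep : ∀ m, m * d = n → trial fr sq f m (d :: l) = true → locInd L m = 1 := by
        intro m hm ht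
        have hm0 : m ≠ 0 := by rintro rfl; simp at hm; exact hn hm.symm
        exact ih (d :: l) m hl hlp hm0
          ((Nat.le_of_dvd (Nat.pos_of_ne_zero hn) ⟨d, hm.symm⟩).trans_lt hB)
          (fun p hp hpm => hdiv p hp (hpm.trans ⟨d, hm.symm⟩)) ht
      rw [trial_cons] at h
      split_ifs at h with h1 h2 h3 h4 h5 h6
      · have hm : n / d * d = n := Nat.div_mul_cancel (Nat.dvd_of_mod_eq_zero h2)
        rw [← hm]
        exact locInd_mul hL (hstep _ hm h) (by simpa using hprime d hd.1 1 (hfr d h3))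
      · have hm : n / d * d = n := Nat.div_mul_cancel (Nat.dvd_of_mod_eq_zero h2)
        have hm' : n / d / d * d = n / d := Nat.div_mul_cancel (Nat.dvd_of_mod_eq_zero h5)
        have e : n / d / d * d ^ 2 = n := by rw [pow_two, ← mul_assoc, hm', hm]
        have hm0 : n / d / d ≠ 0 := by intro h7; rw [h7] at e; simp at e; exact hn e.symm
        have hr := ih (d :: l) (n / d / d) hl hlp hm0
          ((Nat.le_of_dvd (Nat.pos_of_ne_zero hn) ⟨_, e.symm⟩).trans_lt hB)
          (fun p hp hpm => hdiv p hp (hpm.trans ⟨_, e.symm⟩)) h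
        rw [← e]
        exact locInd_mul hL hr (hprime d hd.1 2 (hsq d h4))
      · refine ih l n (List.pairwise_cons.1 hl).2 (fun p hp => hlp p (List.mem_cons_of_mem _ hp))
          hn hB (fun p hp hpn => ?_) h
        rcases hdiv p hp hpn with h7 | h7
        · rcases List.mem_cons.1 h7 with rfl | h8
          · exact absurd (Nat.mod_eq_zero_of_dvd hpn) h2
          · exact Or.inl h8
        · exact Or.inr h7
      all_goals
        refine hend d n hn (fun p hp hpn => ?_) (by omega) (by simp_all)
        rcases hdiv p hp hpn with h7 | h7
        · rcases List.mem_cons.1 h7 with rfl | h8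
          · exact le_rfl
          · exact (List.pairwise_cons.1 hl).1 p h8
        · exact hd.2.trans h7

/-- Processes `f` consecutive integers starting with `n`: a counter is increased if `t` holds and
decreased if `a` holds, and it has to stay above the function `G`. The result is `0` on failure and
the successor of the final value of the counter otherwise. -/
noncomputable def scanBlock (t a : ℕ → Bool) (G : ℕ → ℕ) (f : ℕ) : ℕ → ℕ → ℕ :=
  Nat.rec (fun _ s => Nat.succ s) (fun _ ih n s =>
    force n fun n => Nat.rec 0 (fun s _ => ifb (Nat.ble (G n) s) (ih (Nat.succ n) s) 0)
      (ifb (t n) (ifb (a n) (Nat.succ s) (Nat.succ (Nat.succ s)))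
        (ifb (a n) s (Nat.succ s)))) f

/-- Processes `f` consecutive blocks of length `w`. -/
noncomputable def scan (t a : ℕ → Bool) (G : ℕ → ℕ) (w f : ℕ) : ℕ → ℕ → Bool :=
  Nat.rec (fun _ _ => true) (fun _ ih n s =>
    Nat.rec false (fun s _ => ih (Nat.add n w) s) (scanBlock t a G w n s)) f

lemma scanBlock_sound {t a : ℕ → Bool} {G : ℕ → ℕ} {E : ℕ → ℝ} {B : ℕ}
    (hE : ∀ m, 0 < m → m < B →
      E m + (if t m = true then 1 else 0) - (if a m = true then 1 else 0) ≤ E (m + 1))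
    (f : ℕ) : ∀ n s r : ℕ, 0 < n → n + f ≤ B → (s : ℝ) ≤ E n → scanBlock t a G f n s = r + 1 →
      (r : ℝ) ≤ E (n + f) ∧ ∀ i < f, (G (n + i) : ℝ) ≤ E (n + i + 1) := by
  induction f with
  | zero =>
    intro n s r _ _ hs h
    have : s = r := Nat.succ.inj h
    subst this
    exact ⟨hs, fun i hi => absurd hi (Nat.not_lt_zero i)⟩
  | succ f ih =>
    intro n s r hn hB hs h
    have hEn := hE n hn (by omega)
    change force n (fun n => Nat.rec 0
      (fun s _ => ifb (Nat.ble (G n) s) (scanBlock t a G f (n + 1) s) 0)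
      (ifb (t n) (ifb (a n) (s + 1) (s + 2)) (ifb (a n) s (s + 1)))) = r + 1 at h
    rw [force_eq] at h
    simp only [ifb_eq, Nat.ble_eq] at h
    have key : ∀ x : ℕ, (x : ℝ) ≤ E (n + 1) + 1 →
        (Nat.rec 0 (fun s _ => if G n ≤ s then scanBlock t a G f (n + 1) s else 0) x : ℕ) = r + 1 →
        (r : ℝ) ≤ E (n + (f + 1)) ∧ ∀ i < f + 1, (G (n + i) : ℝ) ≤ E (n + i + 1) := by
      intro x hx hr
      cases x with
      | zero => simp at hr
      | succ s' =>
        change (if G n ≤ s' then scanBlock t a G f (n + 1) s' else 0) = r + 1 at hr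
        split_ifs at hr with hG
        push_cast at hx
        have hs' : (s' : ℝ) ≤ E (n + 1) := by linarith
        obtain ⟨h1, h2⟩ := ih (n + 1) s' r (by omega) (by omega) hs' hr
        refine ⟨by rwa [show n + (f + 1) = n + 1 + f by ring], fun i hi => ?_⟩
        cases i with
        | zero => exact (Nat.cast_le.2 hG).trans hs'
        | succ i =>
          rw [show n + (i + 1) = n + 1 + i by ring]
          exact h2 i (by omega)
    refine key _ ?_ h
    split_ifs at hEn ⊢ <;> push_cast <;> linarith

lemma scan_sound {t a : ℕ → Bool} {G : ℕ → ℕ} {E : ℕ → ℝ} {B : ℕ}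
    (hE : ∀ m, 0 < m → m < B →
      E m + (if t m = true then 1 else 0) - (if a m = true then 1 else 0) ≤ E (m + 1))
    (w f : ℕ) : ∀ n s : ℕ, 0 < n → n + w * f ≤ B → (s : ℝ) ≤ E n → scan t a G w f n s = true →
      ∀ i < w * f, (G (n + i) : ℝ) ≤ E (n + i + 1) := by
  induction f with
  | zero => intro n s _ _ _ _ i hi; exact absurd hi (Nat.not_lt_zero i)
  | succ f ih =>
    intro n s hn hB hs h i hi
    rw [mul_add, mul_one] at hB hi
    change (Nat.rec false (fun s _ => scan t a G w f (n + w) s) (scanBlock t a G w n s) : Bool)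
      = true at h
    cases hr : scanBlock t a G w n s with
    | zero => rw [hr] at h; cases h
    | succ r =>
      rw [hr] at h
      change scan t a G w f (n + w) r = true at h
      obtain ⟨h1, h2⟩ := scanBlock_sound hE w n s r hn (by omega) hs hr
      rcases Nat.lt_or_ge i w with h3 | h3
      · exact h2 i h3
      · have := ih (n + w) r (by omega) (by omega) h1 h (i - w) (by omega)
        rwa [show n + w + (i - w) = n + i by omega] at this

/-- The value at `n` of the step function with jumps given by `l`. -/
noncomputable def stepNat (l : List (ℕ × ℕ)) (n : ℕ) : ℕ :=
  List.rec 0 (fun x _ s => ifb (Nat.ble x.1 n) (Nat.add x.2 s) s) l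

lemma cast_stepNat (l : List (ℕ × ℕ)) (n : ℕ) : (stepNat l n : ℝ) = stepFun l n := by
  induction l with
  | nil => simp [stepNat, stepFun]
  | cons x l ih =>
    have e : stepNat (x :: l) n = ifb (Nat.ble x.1 n) (x.2 + stepNat l n) (stepNat l n) := rfl
    have e' : stepFun (x :: l) n = (if x.1 ≤ n then (x.2 : ℝ) else 0) + stepFun l n := by
      simp [stepFun]
    rw [e, e', ← ih]
    simp only [ifb_eq, Nat.ble_eq]
    split_ifs <;> simp

/-- Tests that `n` has no divisors in `l`. -/
noncomputable def avoids (l : List ℕ) (n : ℕ) : Bool :=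
  List.rec true (fun x _ s => ifb (Nat.beq (Nat.mod n x) 0) false s) l

lemma avoids_eq_true {l : List ℕ} {n : ℕ} (h : ∀ x ∈ l, ¬ x ∣ n) : avoids l n = true := by
  induction l with
  | nil => rfl
  | cons x l ih =>
    change ifb (Nat.beq (n % x) 0) false (avoids l n) = true
    have hx : ¬ n % x = 0 := fun h' => h x List.mem_cons_self (Nat.dvd_of_mod_eq_zero h')
    simp only [ifb_eq, Nat.beq_eq, if_neg hx]
    exact ih fun y hy => h y (List.mem_cons_of_mem _ hy)

lemma locInd_primesMod_eq_one_iff {d a n : ℕ} :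
    locInd (PrimesMod d a) n = 1 ↔ n ≠ 0 ∧ ∀ p, p.Prime → p ∣ n → p % d = a := by
  rw [locInd_eq_one_iff]
  refine and_congr_right fun hn => forall₂_congr fun p hp => ?_
  have := hp.dvd_iff_one_le_factorization hn
  unfold PrimesMod
  rw [this]
  constructor
  · rintro (h | h) h'
    · omega
    · exact h
  · intro h
    by_cases h' : n.factorization p = 0
    · exact Or.inl h'
    · exact Or.inr (h (Nat.pos_of_ne_zero h'))

lemma modEq_one_of_forall_prime {d n : ℕ} (h0 : n ≠ 0)
    (h : ∀ p, p.Prime → p ∣ n → p ≡ 1 [MOD d]) : n ≡ 1 [MOD d] := by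
  induction n using Nat.recOnMul with
  | zero => exact absurd rfl h0
  | one => rfl
  | prime p hp => exact h p hp dvd_rfl
  | mul a b ha hb =>
    obtain ⟨ha0, hb0⟩ := mul_ne_zero_iff.1 h0
    simpa using (ha ha0 fun p hp hpa => h p hp (hpa.mul_right b)).mul
      (hb hb0 fun p hp hpb => h p hp (hpb.mul_left a))

/-- The primes below `119`. -/
def smallPrimes : List ℕ := [2, 3, 5, 7, 11, 13, 17, 19, 23, 29, 31, 37, 41, 43, 47, 53, 59, 61, 67,
  71, 73, 79, 83, 89, 97, 101, 103, 107, 109, 113]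

lemma mem_smallPrimes {p : ℕ} (hp : p.Prime) : p ∈ smallPrimes ∨ 119 ≤ p := by
  by_contra! h
  obtain ⟨h1, h2⟩ := h
  interval_cases p <;> first | (exact h1 (by decide)) | (revert hp; norm_num)

lemma smallPrimes_prime {p : ℕ} (hp : p ∈ smallPrimes) : p.Prime ∧ p ≤ 119 := by
  revert p
  simp only [smallPrimes, List.forall_mem_cons, List.not_mem_nil, false_imp_iff, implies_true,
    and_true]
  norm_num

lemma locInd_eq_one_of_trial_smallPrimes {L : ℕ → ℕ → Prop} (h0 : ∀ q, L q 0)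
    (hL : ∀ q i j, L q i → L q j → L q (i + j)) {fr sq : ℕ → Bool}
    (hfr : ∀ p, fr p = true → L p 1) (hsq : ∀ p, sq p = true → L p 2) {f n : ℕ} (hn : 0 < n)
    (hn' : n < 14161) (h : trial fr sq f n smallPrimes = true) : locInd L n = 1 :=
  locInd_eq_one_of_trial h0 hL hfr hsq (B := 119) f smallPrimes n (by decide)
    (fun _ hp => smallPrimes_prime hp) hn.ne' hn' (fun _ hp _ => mem_smallPrimes hp) h

/-- A sufficient test for `EvenModFour`. -/
noncomputable def testEvenModFour (n : ℕ) : Bool :=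
  ifb (Nat.beq (Nat.mod n 4) 1) (trial (fun p => Nat.beq (Nat.mod p 4) 1)
    (fun p => Nat.beq (Nat.mod p 4) 3) 60 n smallPrimes) false

/-- A sufficient test for `EvenModThree`. -/
noncomputable def testEvenModThree (n : ℕ) : Bool :=
  trial (fun p => ifb (Nat.beq (Nat.mod p 3) 1) true (Nat.beq p 2))
    (fun p => Nat.beq (Nat.mod p 3) 2) 60 n smallPrimes

/-- A necessary test for `PrimesMod 3 1`. -/
noncomputable def testPrimesModThree (n : ℕ) : Bool :=
  ifb (Nat.beq (Nat.mod n 6) 1)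
    (avoids [5, 11, 17, 23, 29, 41, 47, 53, 59, 71, 83, 89, 101, 107, 113] n) false

/-- A necessary test for `PrimesMod 4 1`. -/
noncomputable def testPrimesModFour (n : ℕ) : Bool :=
  ifb (Nat.beq (Nat.mod n 4) 1)
    (avoids [3, 7, 11, 19, 23, 31, 43, 47, 59, 67, 71, 79, 83, 103, 107] n) false

lemma testEvenModFour_sound {n : ℕ} (hn : 0 < n) (hn' : n < 14161)
    (h : testEvenModFour n = true) : locInd EvenModFour n = 1 := by
  simp only [testEvenModFour, ifb_eq] at h
  split_ifs at h
  refine locInd_eq_one_of_trial_smallPrimes (fun q => ⟨fun _ => rfl, fun _ => rfl⟩)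
    (fun q i j hi hj => by unfold EvenModFour at *; omega) (fun p hp => ?_) (fun p hp => ?_)
    hn hn' h
  · have : p % 4 = 1 := Nat.eq_of_beq_eq_true hp
    unfold EvenModFour; omega
  · have : p % 4 = 3 := Nat.eq_of_beq_eq_true hp
    unfold EvenModFour; omega

lemma testEvenModThree_sound {n : ℕ} (hn : 0 < n) (hn' : n < 14161)
    (h : testEvenModThree n = true) : locInd EvenModThree n = 1 := by
  refine locInd_eq_one_of_trial_smallPrimes (fun q => ⟨fun _ => rfl, fun _ => rfl⟩)
    (fun q i j hi hj => by unfold EvenModThree at *; omega) (fun p hp => ?_) (fun p hp => ?_)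
    hn hn' h
  · have : p % 3 = 1 ∨ p = 2 := by
      rw [ifb_eq] at hp
      split_ifs at hp with h1
      · exact Or.inl (Nat.eq_of_beq_eq_true h1)
      · exact Or.inr (Nat.eq_of_beq_eq_true hp)
    unfold EvenModThree; omega
  · have : p % 3 = 2 := Nat.eq_of_beq_eq_true hp
    unfold EvenModThree; omega

lemma testPrimesModThree_of_locInd {n : ℕ} (h : locInd (PrimesMod 3 1) n = 1) :
    testPrimesModThree n = true := by
  rw [locInd_primesMod_eq_one_iff] at h
  have h3 : n % 3 = 1 := modEq_one_of_forall_prime h.1 h.2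
  have h2 : ¬ 2 ∣ n := fun h' => by simpa using h.2 2 Nat.prime_two h'
  rw [testPrimesModThree, ifb_eq, if_pos (by rw [Nat.beq_eq]; show n % 6 = 1; omega)]
  refine avoids_eq_true ?_
  simp only [List.forall_mem_cons, List.not_mem_nil, false_imp_iff, implies_true, and_true]
  refine ⟨?_, ?_, ?_, ?_, ?_, ?_, ?_, ?_, ?_, ?_, ?_, ?_, ?_, ?_, ?_⟩ <;>
    exact fun h' => absurd (h.2 _ (by norm_num) h') (by norm_num)

lemma testPrimesModFour_of_locInd {n : ℕ} (h : locInd (PrimesMod 4 1) n = 1) :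
    testPrimesModFour n = true := by
  rw [locInd_primesMod_eq_one_iff] at h
  have h4 : n % 4 = 1 := modEq_one_of_forall_prime h.1 h.2
  rw [testPrimesModFour, ifb_eq, if_pos (by rw [Nat.beq_eq]; exact h4)]
  refine avoids_eq_true ?_
  simp only [List.forall_mem_cons, List.not_mem_nil, false_imp_iff, implies_true, and_true]
  refine ⟨?_, ?_, ?_, ?_, ?_, ?_, ?_, ?_, ?_, ?_, ?_, ?_, ?_, ?_, ?_⟩ <;>
    exact fun h' => absurd (h.2 _ (by norm_num) h') (by norm_num)

lemma stepFun_le_of_scan {T A : ℕ → ℕ → Prop} {t a : ℕ → Bool} {l : List (ℕ × ℕ)}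
    (ht : ∀ n, 0 < n → n < 14161 → t n = true → locInd T n = 1)
    (ha : ∀ n, locInd A n = 1 → a n = true)
    (h : scan t a (stepNat l) 100 140 1 0 = true) {n : ℕ} (hn : 0 < n) (hn' : n ≤ 14000) :
    stepFun l n ≤ psum (locInd T) n - psum (locInd A) n := by
  have := scan_sound (E := fun m => psum (locInd T) (m - 1) - psum (locInd A) (m - 1))
    (B := 14161) (t := t) (a := a) (G := stepNat l) (fun m hm hB => ?_) 100 140 1 0 (by norm_num)
    (by norm_num) (by simp) h (n - 1) (by omega)
  · rw [show 1 + (n - 1) = n by omega, cast_stepNat] at this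
    exact this
  · obtain ⟨m, rfl⟩ : ∃ k, m = k + 1 := ⟨m - 1, by omega⟩
    simp only [Nat.add_sub_cancel, psum_succ]
    have h1 : (if t (m + 1) = true then (1 : ℝ) else 0) ≤ locInd T (m + 1) := by
      split_ifs with h1
      · exact (ht _ hm hB h1).ge
      · exact locInd_nonneg _ _
    have h2 : locInd A (m + 1) ≤ if a (m + 1) = true then (1 : ℝ) else 0 := by
      rcases locInd_eq_zero_or_one A (m + 1) with h2 | h2
      · rw [h2]; split_ifs <;> norm_num
      · rw [if_pos (ha _ h2), h2]
    linarith

set_option maxRecDepth 100000 in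
lemma scan_stepsFour :
    scan testEvenModFour testPrimesModThree (stepNat stepsFour) 100 140 1 0 = true := by
  decide +kernel

set_option maxRecDepth 100000 in
lemma scan_stepsThree :
    scan testEvenModThree testPrimesModFour (stepNat stepsThree) 100 140 1 0 = true := by
  decide +kernel

lemma stepFun_nonneg (l : List (ℕ × ℕ)) (n : ℕ) : 0 ≤ stepFun l n := by
  rw [← cast_stepNat]
  positivity

lemma psum_primesMod_three_le_evenModFour (N : ℕ) :
    psum (locInd (PrimesMod 3 1)) N ≤ psum (locInd EvenModFour) N := by
  have hK : ∀ n, 0 < n → n ≤ 14000 →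
      stepFun stepsFour n ≤ psum (locInd EvenModFour) n - psum (locInd (PrimesMod 3 1)) n :=
    fun n hn hn' => stepFun_le_of_scan (fun _ => testEvenModFour_sound)
      (fun _ => testPrimesModThree_of_locInd) scan_stepsFour hn hn'
  rw [← sub_nonneg]
  induction N using Nat.strong_induction_on with
  | _ N ih =>
    rcases Nat.eq_zero_or_pos N with rfl | h0
    · simp
    rcases le_or_gt N 14000 with h1 | h1
    · exact (stepFun_nonneg _ _).trans (hK N h0 h1)
    · exact evenModFour_sub_primesMod_nonneg h1 ih hK

lemma psum_primesMod_four_le_evenModThree (N : ℕ) :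
    psum (locInd (PrimesMod 4 1)) N ≤ psum (locInd EvenModThree) N := by
  have hK : ∀ n, 0 < n → n ≤ 14000 →
      stepFun stepsThree n ≤ psum (locInd EvenModThree) n - psum (locInd (PrimesMod 4 1)) n :=
    fun n hn hn' => stepFun_le_of_scan (fun _ => testEvenModThree_sound)
      (fun _ => testPrimesModFour_of_locInd) scan_stepsThree hn hn'
  rw [← sub_nonneg]
  induction N using Nat.strong_induction_on with
  | _ N ih =>
    rcases Nat.eq_zero_or_pos N with rfl | h0
    · simp
    rcases le_or_gt N 14000 with h1 | h1
    · exact (stepFun_nonneg _ _).trans (hK N h0 h1)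
    · exact evenModThree_sub_primesMod_nonneg h1 ih hK

lemma psum_mul_le {f g : ArithmeticFunction ℝ} (hf : ∀ n, 0 ≤ f n) (hg : ∀ n, psum g n ≤ 1)
    (N : ℕ) : psum (f * g) N ≤ psum f N := by
  rw [psum_mul]
  exact sum_le_sum fun n _ => mul_le_of_le_one_right (hf n) (hg _)

lemma psum_evenModFour_le (N : ℕ) :
    psum (locInd EvenModFour) N ≤ psum (locInd (PrimesMod 4 3)) N := by
  rw [← locInd_primesMod_mul_chiFour]
  refine psum_mul_le (locInd_nonneg _) (fun n => ?_) N
  rw [psum_chiFour]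
  split_ifs <;> norm_num

lemma psum_evenModThree_le (N : ℕ) :
    psum (locInd EvenModThree) N ≤ psum (locInd (PrimesMod 3 2)) N := by
  rw [← locInd_primesMod_mul_chiSix]
  refine psum_mul_le (locInd_nonneg _) (fun n => ?_) N
  rw [psum_chiSix]
  split_ifs <;> norm_num

lemma locInd_mono {L L' : ℕ → ℕ → Prop} (h : ∀ q k, L q k → L' q k) (n : ℕ) :
    locInd L n ≤ locInd L' n := by
  rcases locInd_eq_zero_or_one L n with h' | h'
  · rw [h']
    exact locInd_nonneg _ _
  · have := locInd_eq_one_iff.1 h'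
    rw [h', locInd_eq_one_iff.2 ⟨this.1, fun q hq => h _ _ (this.2 q hq)⟩]

lemma cast_setCount {d a : ℕ} (had : a < d) {x : ℝ} (hx : 0 ≤ x) :
    (setCount (SArith d a) x : ℝ) = psum (locInd (PrimesMod d a)) ⌊x⌋₊ := by
  have e : {n : ℕ | 0 < n ∧ (n : ℝ) ≤ x ∧ n ∈ SArith d a} =
      ((Ioc 0 ⌊x⌋₊).filter fun n => locInd (PrimesMod d a) n = 1 : Finset ℕ) := by
    ext n
    simp only [Set.mem_ofPred_eq, coe_filter, mem_Ioc, SArith, Nat.le_floor_iff hx,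
      locInd_primesMod_eq_one_iff, Nat.mod_eq_of_lt had, Nat.pos_iff_ne_zero]
    tauto
  rw [setCount, e, Set.ncard_coe_finset, card_filter, psum]
  push_cast
  refine sum_congr rfl fun n _ => ?_
  rcases locInd_eq_zero_or_one (PrimesMod d a) n with h | h <;> simp [h]

lemma setCount_le_setCount {d a d' a' : ℕ} (had : a < d) (had' : a' < d')
    (h : ∀ N, psum (locInd (PrimesMod d a)) N ≤ psum (locInd (PrimesMod d' a')) N) {x : ℝ}
    (hx : 0 ≤ x) : setCount (SArith d a) x ≤ setCount (SArith d' a') x := by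
  have := h ⌊x⌋₊
  rw [← cast_setCount had hx, ← cast_setCount had' hx] at this
  exact_mod_cast this

end PrimeRace

open PrimeRace

/-- Multiplicative set races for integers composed of primes in an arithmetic
progression: for every `x ≥ 0` one has `S'_{3;2}(x) ≥ S'_{3;1}(x)`,
`S'_{4;3}(x) ≥ S'_{3;1}(x)`, `S'_{3;2}(x) ≥ S'_{4;1}(x)` and
`S'_{4;3}(x) ≥ S'_{4;1}(x)`. -/
theorem arith_progression_races :
    ∀ x : ℝ, 0 ≤ x →
      setCount (SArith 3 1) x ≤ setCount (SArith 3 2) x ∧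
      setCount (SArith 3 1) x ≤ setCount (SArith 4 3) x ∧
      setCount (SArith 4 1) x ≤ setCount (SArith 3 2) x ∧
      setCount (SArith 4 1) x ≤ setCount (SArith 4 3) x := by
  intro x hx
  refine ⟨setCount_le_setCount (by norm_num) (by norm_num) (fun N => ?_) hx,
    setCount_le_setCount (by norm_num) (by norm_num) (fun N => ?_) hx,
    setCount_le_setCount (by norm_num) (by norm_num) (fun N => ?_) hx,
    setCount_le_setCount (by norm_num) (by norm_num) (fun N => ?_) hx⟩
  · exact (psum_mono (locInd_mono fun q k h => by
      unfold PrimesMod at h; unfold EvenModThree; omega) N).trans (psum_evenModThree_le N)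
  · exact (psum_primesMod_three_le_evenModFour N).trans (psum_evenModFour_le N)
  · exact (psum_primesMod_four_le_evenModThree N).trans (psum_evenModThree_le N)
  · exact (psum_mono (locInd_mono fun q k h => by
      unfold PrimesMod at h; unfold EvenModFour; omega) N).trans (psum_evenModFour_le N)
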